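/- arXiv:1312.4030 — 4 statements merged into one kernel-verified Lean document; each statement's English description precedes it below -/
import Mathlib

section
/- Let F_k(z, y₁, …, y_m), k = 1, …, m, be analytic and bounded in modulus by K on the closed polydisc D = {|z − z₀| ≤ r} × {|y₁ − η₁| ≤ r} × ⋯ × {|y_m − η_m| ≤ r}. Then the initial value problem y_k' = F_k(z, y₁, …, y_m) with y_k(z₀) = η_k has a (unique) analytic solution on the disc of radius ρ = r(1 − e^{−1/((m+1)K)}) centred at z₀. -/
open scoped Topology

lemma cq_ray {E : Type*} [NormedAddCommGroup E] [NormedSpace ℂ E] {z₀ : ℂ} {ρ L C : ℝ}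
    (hC : 0 ≤ C) {f f' : ℂ → E}
    (h0 : f z₀ = 0) (hf : ∀ z ∈ Metric.ball z₀ ρ, HasDerivAt f (f' z) z)
    (hb : ∀ z ∈ Metric.ball z₀ ρ, ‖f' z‖ ≤ L * (C * Real.exp (2 * L * ‖z - z₀‖))) :
    ∀ z ∈ Metric.ball z₀ ρ, ‖f z‖ ≤ C / 2 * Real.exp (2 * L * ‖z - z₀‖) := by
  intro z hz
  set d := ‖z - z₀‖ with hd
  have hmem : ∀ t ∈ Set.Icc (0:ℝ) 1, z₀ + (t : ℂ) * (z - z₀) ∈ Metric.ball z₀ ρ := by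
    intro t ht
    rw [mem_ball_iff_norm] at hz ⊢
    rw [add_sub_cancel_left, norm_mul, Complex.norm_real, Real.norm_of_nonneg ht.1]
    nlinarith [norm_nonneg (z - z₀), ht.2]
  have hder : ∀ t ∈ Set.Icc (0:ℝ) 1, HasDerivAt (fun t : ℝ => f (z₀ + (t : ℂ) * (z - z₀)))
      ((z - z₀) • f' (z₀ + (t : ℂ) * (z - z₀))) t := by
    intro t ht
    have h1 : HasDerivAt (fun t : ℝ => z₀ + (t : ℂ) * (z - z₀)) (z - z₀) t := by
      have := ((Complex.ofRealCLM.hasDerivAt (x := t)).mul_const (z - z₀)).const_add z₀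
      simpa using this
    exact (hf _ (hmem t ht)).scomp t h1
  have key := image_norm_le_of_norm_deriv_right_le_deriv_boundary (a := (0:ℝ)) (b := 1)
    (f := fun t : ℝ => f (z₀ + (t : ℂ) * (z - z₀)))
    (f' := fun t : ℝ => (z - z₀) • f' (z₀ + (t : ℂ) * (z - z₀)))
    (B := fun t => C / 2 * Real.exp (2 * L * (t * d)))
    (B' := fun t => C / 2 * (Real.exp (2 * L * (t * d)) * (2 * L * (1 * d))))
    (fun t ht => (hder t ht).continuousAt.continuousWithinAt)
    (fun t ht => (hder t ⟨ht.1, ht.2.le⟩).hasDerivWithinAt)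
    (by simp [h0]; positivity)
    (fun t => ((((hasDerivAt_id t).mul_const d).const_mul (2 * L)).exp).const_mul (C / 2))
    (by
      intro t ht
      have h2 := hb _ (hmem t ⟨ht.1, ht.2.le⟩)
      rw [add_sub_cancel_left, norm_mul, Complex.norm_real, Real.norm_of_nonneg ht.1, ← hd] at h2
      rw [norm_smul, ← hd]
      have := mul_le_mul_of_nonneg_left h2 (norm_nonneg (z - z₀))
      rw [← hd] at this
      refine this.trans (le_of_eq ?_)
      ring)
  have := key (Set.right_mem_Icc.2 zero_le_one)
  simpa using this

lemma cq_core {E : Type*} [NormedAddCommGroup E] [NormedSpace ℂ E] [CompleteSpace E]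
    {z₀ : ℂ} {η : E} {r ρ K L : ℝ} (hr : 0 < r) (hρ : 0 < ρ) (hρr : ρ ≤ r) (hK : 0 < K)
    (hKρ : K * ρ ≤ r) (hL0 : 0 ≤ L)
    {G : ℂ × E → E} (hG : ∀ p ∈ Metric.closedBall (z₀, η) r, DifferentiableAt ℂ G p)
    (hGK : ∀ p ∈ Metric.closedBall (z₀, η) r, ‖G p‖ ≤ K)
    (hL : ∀ p ∈ Metric.closedBall (z₀, η) r, ∀ q ∈ Metric.closedBall (z₀, η) r,
      ‖G p - G q‖ ≤ L * ‖p - q‖) :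
    ∃ y : ℂ → E, y z₀ = η ∧ ∀ z ∈ Metric.ball z₀ ρ,
      (z, y z) ∈ Metric.closedBall (z₀, η) r ∧ HasDerivAt y (G (z, y z)) z := by
  classical
  set B := Metric.ball z₀ ρ with hB
  set D := Metric.closedBall (z₀, η) r with hD
  have hz0B : z₀ ∈ B := Metric.mem_ball_self hρ
  have memD : ∀ z ∈ B, ∀ w : E, ‖w - η‖ ≤ r → (z, w) ∈ D := by
    intro z hz w hw
    rw [hB, Metric.mem_ball] at hz
    rw [hD, Metric.mem_closedBall, Prod.dist_eq]
    exact max_le (hz.le.trans hρr) (by rwa [dist_eq_norm])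
  have memD' : ∀ z, ∀ w : E, (z, w) ∈ D → ‖w - η‖ ≤ r := by
    intro z w h
    rw [hD, Metric.mem_closedBall, Prod.dist_eq] at h
    rw [← dist_eq_norm]; exact (le_max_right _ _).trans h
  let S := {y : ℂ → E // DifferentiableOn ℂ y B ∧ ∀ z ∈ B, (z, y z) ∈ D}
  have step : ∀ y : S, ∃ P : S, P.1 z₀ = η ∧ ∀ z ∈ B, HasDerivAt P.1 (G (z, y.1 z)) z := by
    rintro ⟨y, hy, hyD⟩
    have hd : DifferentiableOn ℂ (fun z => G (z, y z)) B := by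
      intro z hz
      exact ((hG _ (hyD z hz)).comp_differentiableWithinAt z
        (differentiableWithinAt_id.prodMk (hy z hz)))
    obtain ⟨P, hP0, hP⟩ := hd.isExactOn_ball.with_val_at z₀ η
    refine ⟨⟨P, fun z hz => (hP z hz).differentiableAt.differentiableWithinAt, ?_⟩, hP0, hP⟩
    intro z hz
    apply memD z hz
    have := (convex_ball z₀ ρ).norm_image_sub_le_of_norm_hasDerivWithin_le
      (fun x hx => (hP x hx).hasDerivWithinAt) (fun x hx => hGK _ (hyD x hx)) hz0B hz
    rw [hP0] at this
    refine this.trans (le_trans ?_ hKρ)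
    rw [hB, mem_ball_iff_norm] at hz
    gcongr
  choose P hP0 hP using step
  let y₀ : S := ⟨fun _ => η, differentiableOn_const _, fun z hz => memD z hz _ (by simp [hr.le])⟩
  let u : ℕ → S := fun n => P^[n] y₀
  have hu : ∀ n, u (n+1) = P (u n) := fun n => Function.iterate_succ_apply' P n y₀
  have hu0 : ∀ n, (u n).1 z₀ = η := by
    intro n
    cases n with
    | zero => rfl
    | succ n => rw [hu]; exact hP0 _
  have hud : ∀ n, ∀ z ∈ B, HasDerivAt (u (n+1)).1 (G (z, (u n).1 z)) z := by
    intro n z hz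
    rw [hu]; exact hP _ z hz
  have hest : ∀ n, ∀ z ∈ B, ‖(u (n+1)).1 z - (u n).1 z‖ ≤
      r / 2 ^ n * Real.exp (2 * L * ‖z - z₀‖) := by
    intro n
    induction n with
    | zero =>
      intro z hz
      have h1 := memD' _ _ ((u 1).2.2 z hz)
      have h2 : (1:ℝ) ≤ Real.exp (2 * L * ‖z - z₀‖) := Real.one_le_exp (by positivity)
      have h3 : (u 0).1 z = η := rfl
      rw [h3]
      simp only [zero_add, pow_zero, div_one]
      nlinarith
    | succ n ih =>
      have := cq_ray (z₀ := z₀) (ρ := ρ) (L := L) (C := r / 2 ^ n) (by positivity)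
        (f := fun z => (u (n+1+1)).1 z - (u (n+1)).1 z)
        (f' := fun z => G (z, (u (n+1)).1 z) - G (z, (u n).1 z))
        (by simp [hu0])
        (fun z hz => (hud (n+1) z hz).sub (hud n z hz))
        (fun z hz => by
          refine (hL _ ((u (n+1)).2.2 z hz) _ ((u n).2.2 z hz)).trans ?_
          gcongr
          refine le_trans (le_of_eq ?_) (ih z hz)
          simp [Prod.norm_def])
      intro z hz
      refine (this z hz).trans (le_of_eq ?_)
      rw [pow_succ]; field_simp
  set M := r * Real.exp (2 * L * ρ) * 2 with hM
  have hdist : ∀ z ∈ B, ∀ n, dist ((u n).1 z) ((u (n+1)).1 z) ≤ M / 2 / 2 ^ n := by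
    intro z hz n
    rw [dist_comm, dist_eq_norm]
    refine (hest n z hz).trans ?_
    rw [hB, mem_ball_iff_norm] at hz
    have : Real.exp (2 * L * ‖z - z₀‖) ≤ Real.exp (2 * L * ρ) := by
      gcongr
    calc _ ≤ r / 2 ^ n * Real.exp (2 * L * ρ) := by gcongr
      _ = _ := by rw [hM]; field_simp
  have hlim : ∀ z, ∃ w, z ∈ B → Filter.Tendsto (fun n => (u n).1 z) Filter.atTop (𝓝 w) := by
    intro z
    by_cases hz : z ∈ B
    · obtain ⟨w, hw⟩ := cauchySeq_tendsto_of_complete (cauchySeq_of_le_geometric_two (hdist z hz))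
      exact ⟨w, fun _ => hw⟩
    · exact ⟨0, fun h => absurd h hz⟩
  choose y hy using hlim
  have hunif : TendstoUniformlyOn (fun n => (u n).1) y Filter.atTop B := by
    rw [Metric.tendstoUniformlyOn_iff]
    intro ε hε
    have ht : Filter.Tendsto (fun n : ℕ => M / 2 ^ n) Filter.atTop (𝓝 0) := by
      have := (tendsto_pow_atTop_nhds_zero_of_lt_one (r := (1/2:ℝ)) (by norm_num)
        (by norm_num)).const_mul M
      simpa [div_eq_mul_inv] using this
    filter_upwards [ht.eventually_lt_const hε] with n hn z hz
    rw [dist_comm]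
    exact (dist_le_of_le_geometric_two_of_tendsto (hdist z hz) (hy z hz) n).trans_lt hn
  have hdiff : DifferentiableOn ℂ y B := hunif.tendstoLocallyUniformlyOn.differentiableOn
    (Filter.Eventually.of_forall fun n => (u n).2.1) Metric.isOpen_ball
  have hderiv := hunif.tendstoLocallyUniformlyOn.deriv
    (Filter.Eventually.of_forall fun n => (u n).2.1) Metric.isOpen_ball
  refine ⟨y, ?_, ?_⟩
  · refine tendsto_nhds_unique (hy z₀ hz0B) ?_
    simp [hu0]
  · intro z hz
    have hpt : Filter.Tendsto (fun n => (z, (u n).1 z)) Filter.atTop (𝓝 (z, y z)) :=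
      tendsto_const_nhds.prodMk_nhds (hy z hz)
    have hmem : (z, y z) ∈ D := Metric.isClosed_closedBall.mem_of_tendsto hpt
      (Filter.Eventually.of_forall fun n => (u n).2.2 z hz)
    refine ⟨hmem, ?_⟩
    have h1 := (hG _ hmem).continuousAt.tendsto.comp hpt
    have h2 := (hderiv.tendsto_at hz).comp (Filter.tendsto_add_atTop_nat 1)
    have h3 : deriv y z = G (z, y z) := by
      refine tendsto_nhds_unique h2 (h1.congr fun n => ?_)
      exact ((hud n z hz).deriv).symm
    rw [← h3]
    exact (hdiff.differentiableAt (Metric.isOpen_ball.mem_nhds hz)).hasDerivAt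

lemma cq_unique {E : Type*} [NormedAddCommGroup E] [NormedSpace ℂ E]
    {z₀ : ℂ} {η : E} {r ρ L : ℝ} (hr : 0 < r) (hL0 : 0 ≤ L)
    {G : ℂ × E → E}
    (hL : ∀ p ∈ Metric.closedBall (z₀, η) r, ∀ q ∈ Metric.closedBall (z₀, η) r,
      ‖G p - G q‖ ≤ L * ‖p - q‖) {y Y : ℂ → E} (h0 : y z₀ = Y z₀)
    (hy : ∀ z ∈ Metric.ball z₀ ρ,
      (z, y z) ∈ Metric.closedBall (z₀, η) r ∧ HasDerivAt y (G (z, y z)) z)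
    (hY : ∀ z ∈ Metric.ball z₀ ρ,
      (z, Y z) ∈ Metric.closedBall (z₀, η) r ∧ HasDerivAt Y (G (z, Y z)) z) :
    ∀ z ∈ Metric.ball z₀ ρ, Y z = y z := by
  have hest : ∀ n : ℕ, ∀ z ∈ Metric.ball z₀ ρ, ‖Y z - y z‖ ≤
      2 * r / 2 ^ n * Real.exp (2 * L * ‖z - z₀‖) := by
    intro n
    induction n with
    | zero =>
      intro z hz
      have h1 := dist_triangle_right (z, Y z) (z, y z) (z₀, η)
      have h2 := Metric.mem_closedBall.1 (hy z hz).1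
      have h3 := Metric.mem_closedBall.1 (hY z hz).1
      have h4 : (1:ℝ) ≤ Real.exp (2 * L * ‖z - z₀‖) := Real.one_le_exp (by positivity)
      have h5 : ‖Y z - y z‖ = dist (z, Y z) (z, y z) := by
        simp [Prod.dist_eq, dist_eq_norm]
      rw [h5]
      simp only [pow_zero, div_one]
      nlinarith
    | succ n ih =>
      have := cq_ray (z₀ := z₀) (ρ := ρ) (L := L) (C := 2 * r / 2 ^ n) (by positivity)
        (f := fun z => Y z - y z)
        (f' := fun z => G (z, Y z) - G (z, y z))
        (by simp [h0])
        (fun z hz => (hY z hz).2.sub (hy z hz).2)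
        (fun z hz => by
          refine (hL _ (hY z hz).1 _ (hy z hz).1).trans ?_
          gcongr
          refine le_trans (le_of_eq ?_) (ih z hz)
          simp [Prod.norm_def])
      intro z hz
      refine (this z hz).trans (le_of_eq ?_)
      rw [pow_succ]; field_simp
  intro z hz
  have ht : Filter.Tendsto (fun n : ℕ => 2 * r / 2 ^ n * Real.exp (2 * L * ‖z - z₀‖))
      Filter.atTop (𝓝 0) := by
    have := ((tendsto_pow_atTop_nhds_zero_of_lt_one (r := (1/2:ℝ)) (by norm_num)
      (by norm_num)).const_mul (2 * r)).mul_const (Real.exp (2 * L * ‖z - z₀‖))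
    simpa [div_eq_mul_inv] using this
  have := ge_of_tendsto' ht (fun n => hest n z hz)
  exact sub_eq_zero.1 (norm_le_zero_iff.1 this)

/-- Quantitative Cauchy existence-uniqueness theorem: if the `F_k` are analytic on the
closed polydisc `D` of polyradius `r` around `(z₀, η)` and bounded in modulus by `K`
there, then the initial value problem `y_k' = F_k(z, y₁, …, y_m)`, `y_k(z₀) = η_k`
has a unique analytic solution (staying in the polydisc) on the disc of radius
`ρ = r(1 − exp(−1/((m+1)K)))` centred at `z₀`. -/
theorem cauchy_quantitative_existence (m : ℕ) (hm : 0 < m)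
    (z₀ : ℂ) (η : Fin m → ℂ) (r K : ℝ) (hr : 0 < r) (hK : 0 < K)
    (F : Fin m → ℂ × (Fin m → ℂ) → ℂ)
    (D : Set (ℂ × (Fin m → ℂ)))
    (hD : D = {p | ‖p.1 - z₀‖ ≤ r ∧ ∀ k, ‖p.2 k - η k‖ ≤ r})
    (hF : ∀ k, AnalyticOnNhd ℂ (F k) D)
    (hFbd : ∀ k, ∀ p ∈ D, ‖F k p‖ ≤ K) :
    ∃ y : Fin m → ℂ → ℂ,
      (∀ k, AnalyticOnNhd ℂ (y k)
        (Metric.ball z₀ (r * (1 - Real.exp (-(1 / (((m : ℝ) + 1) * K))))))) ∧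
      (∀ k, y k z₀ = η k) ∧
      (∀ z ∈ Metric.ball z₀ (r * (1 - Real.exp (-(1 / (((m : ℝ) + 1) * K))))),
        (z, fun j => y j z) ∈ D ∧ ∀ k, deriv (y k) z = F k (z, fun j => y j z)) ∧
      ∀ Y : Fin m → ℂ → ℂ,
        (∀ k, AnalyticOnNhd ℂ (Y k)
          (Metric.ball z₀ (r * (1 - Real.exp (-(1 / (((m : ℝ) + 1) * K))))))) →
        (∀ k, Y k z₀ = η k) →
        (∀ z ∈ Metric.ball z₀ (r * (1 - Real.exp (-(1 / (((m : ℝ) + 1) * K))))),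
          (z, fun j => Y j z) ∈ D ∧ ∀ k, deriv (Y k) z = F k (z, fun j => Y j z)) →
        ∀ z ∈ Metric.ball z₀ (r * (1 - Real.exp (-(1 / (((m : ℝ) + 1) * K))))),
          ∀ k, Y k z = y k z := by
  set ρ := r * (1 - Real.exp (-(1 / (((m : ℝ) + 1) * K)))) with hρdef
  have hx : 0 < 1 / (((m : ℝ) + 1) * K) := by positivity
  have hρ : 0 < ρ := by
    have : Real.exp (-(1 / (((m : ℝ) + 1) * K))) < 1 := Real.exp_lt_one_iff.2 (by linarith)
    exact mul_pos hr (by linarith)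
  have hρr : ρ ≤ r := by
    have := Real.exp_pos (-(1 / (((m : ℝ) + 1) * K)))
    rw [hρdef]; nlinarith
  have hKρ : K * ρ ≤ r := by
    have h1 := Real.add_one_le_exp (-(1 / (((m : ℝ) + 1) * K)))
    have h2 : ρ ≤ r * (1 / (((m : ℝ) + 1) * K)) :=
      mul_le_mul_of_nonneg_left (by linarith) hr.le
    calc K * ρ ≤ K * (r * (1 / (((m : ℝ) + 1) * K))) := by gcongr
      _ = r / ((m : ℝ) + 1) := by field_simp
      _ ≤ r := div_le_self hr.le (by linarith [(Nat.cast_nonneg m : (0:ℝ) ≤ m)])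
  clear_value ρ
  have hDD : D = Metric.closedBall (z₀, η) r := by
    rw [hD]; ext p
    rw [Metric.mem_closedBall, Prod.dist_eq, max_le_iff, dist_pi_le_iff hr.le]
    simp [dist_eq_norm]
  clear hD
  subst hDD
  set G : ℂ × (Fin m → ℂ) → (Fin m → ℂ) := fun p k => F k p with hGdef
  have hGan : AnalyticOnNhd ℂ G (Metric.closedBall (z₀, η) r) := fun p hp =>
    AnalyticAt.pi fun k => hF k p hp
  have hG : ∀ p ∈ Metric.closedBall (z₀, η) r, DifferentiableAt ℂ G p :=
    fun p hp => (hGan p hp).differentiableAt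
  have hGK : ∀ p ∈ Metric.closedBall (z₀, η) r, ‖G p‖ ≤ K := fun p hp =>
    (pi_norm_le_iff_of_nonneg hK.le).2 fun k => hFbd k p hp
  obtain ⟨L, hLb⟩ := (isCompact_closedBall (z₀, η) r).exists_bound_of_continuousOn
    hGan.fderiv.continuousOn
  have hL0 : 0 ≤ L := (norm_nonneg _).trans (hLb _ (Metric.mem_closedBall_self hr.le))
  have hL : ∀ p ∈ Metric.closedBall (z₀, η) r, ∀ q ∈ Metric.closedBall (z₀, η) r,
      ‖G p - G q‖ ≤ L * ‖p - q‖ := fun p hp q hq =>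
    (convex_closedBall (z₀, η) r).norm_image_sub_le_of_norm_fderiv_le hG hLb hq hp
  obtain ⟨y, hy0, hy⟩ := cq_core hr hρ hρr hK hKρ hL0 hG hGK hL
  refine ⟨fun k z => y z k, ?_, fun k => congrFun hy0 k, ?_, ?_⟩
  · intro k
    apply DifferentiableOn.analyticOnNhd _ Metric.isOpen_ball
    intro z hz
    exact ((hasDerivAt_pi.1 (hy z hz).2 k).differentiableAt).differentiableWithinAt
  · intro z hz
    exact ⟨(hy z hz).1, fun k => (hasDerivAt_pi.1 (hy z hz).2 k).deriv⟩
  · intro Y hYan hY0 hY z hz k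
    have := cq_unique (ρ := ρ) (Y := fun z j => Y j z) hr hL0 hL
      (by rw [hy0]; funext k; exact (hY0 k).symm) hy
      (fun z hz => ⟨(hY z hz).1, hasDerivAt_pi.2 fun k => by
        have h := (hYan k z hz).differentiableAt.hasDerivAt
        rw [(hY z hz).2 k] at h
        exact h⟩) z hz
    exact congrFun this k
end

section
/- Let γ be a finite-length curve in the complex plane and let P(z), Q(z) and R(z) be functions bounded on γ (with R differentiable along γ). Then any solution W of the first-order linear differential equation W' = P·W + Q + R' along γ is bounded on γ. -/
/-- If `γ` is a finite-length curve in `ℂ` and `P`, `Q`, `R` are bounded on `γ`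
(with `W`, `R` differentiable in a neighbourhood of the curve), then any solution `W`
of `W' = P·W + Q + R'` along `γ` is bounded on `γ`. -/
theorem linear_ode_bounded_on_curve
    (γ : ℝ → ℂ) (hγ : ContinuousOn γ (Set.Ico 0 1))
    (hlen : eVariationOn γ (Set.Ico 0 1) ≠ ⊤)
    (U : Set ℂ) (hU : IsOpen U) (hγU : γ '' Set.Ico 0 1 ⊆ U)
    (P Q R W : ℂ → ℂ)
    (hWd : DifferentiableOn ℂ W U) (hRd : DifferentiableOn ℂ R U)
    (hPb : ∃ Bp : ℝ, ∀ z ∈ γ '' Set.Ico 0 1, ‖P z‖ ≤ Bp)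
    (hQb : ∃ Bq : ℝ, ∀ z ∈ γ '' Set.Ico 0 1, ‖Q z‖ ≤ Bq)
    (hRb : ∃ Br : ℝ, ∀ z ∈ γ '' Set.Ico 0 1, ‖R z‖ ≤ Br)
    (hode : ∀ z ∈ γ '' Set.Ico 0 1, deriv W z = P z * W z + Q z + deriv R z) :
    ∃ B : ℝ, ∀ z ∈ γ '' Set.Ico 0 1, ‖W z‖ ≤ B := by
  obtain ⟨Bp, hP⟩ := hPb
  obtain ⟨Bq, hQ⟩ := hQb
  obtain ⟨Br, hR⟩ := hRb
  have h0 : (0:ℝ) ∈ Set.Ico (0:ℝ) 1 := by simp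
  set S := Set.Ico (0:ℝ) 1 with hS
  have hbv : LocallyBoundedVariationOn γ S :=
    BoundedVariationOn.locallyBoundedVariationOn hlen
  set l : ℝ → ℝ := variationOnFromTo γ S 0 with hl
  have hBp : 0 ≤ Bp := (norm_nonneg _).trans (hP _ ⟨0, h0, rfl⟩)
  have hBq : 0 ≤ Bq := (norm_nonneg _).trans (hQ _ ⟨0, h0, rfl⟩)
  have hBr : 0 ≤ Br := (norm_nonneg _).trans (hR _ ⟨0, h0, rfl⟩)
  set a : ℝ := Bp + 1 with ha
  set c : ℝ := Bp * Br + Bq + 1 with hc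
  have hc0 : 0 ≤ c := by positivity
  have ha0 : 0 ≤ a := by positivity
  let f : ℝ → ℂ := fun t => W (γ t) - R (γ t)
  have hVd : ∀ t ∈ S, HasDerivAt (fun z => W z - R z) (deriv W (γ t) - deriv R (γ t)) (γ t) := by
    intro t ht
    have hn : U ∈ nhds (γ t) := hU.mem_nhds (hγU ⟨t, ht, rfl⟩)
    exact ((hWd.differentiableAt hn).hasDerivAt).sub ((hRd.differentiableAt hn).hasDerivAt)
  have hfc : ContinuousOn f S := by
    intro t ht
    exact (hVd t ht).continuousAt.comp_continuousWithinAt (f := γ) (hγ t ht)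
  have hder : ∀ t ∈ S, ‖deriv W (γ t) - deriv R (γ t)‖ + 1 ≤ a * (‖f t‖ + c) := by
    intro t ht
    have hm : γ t ∈ γ '' S := ⟨t, ht, rfl⟩
    have e : deriv W (γ t) - deriv R (γ t) = P (γ t) * f t + P (γ t) * R (γ t) + Q (γ t) := by
      rw [hode _ hm]; simp only [f]; ring
    have h1 : ‖P (γ t) * f t‖ ≤ Bp * ‖f t‖ := by
      rw [norm_mul]; exact mul_le_mul_of_nonneg_right (hP _ hm) (norm_nonneg _)
    have h2 : ‖P (γ t) * R (γ t)‖ ≤ Bp * Br := by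
      rw [norm_mul]; exact mul_le_mul (hP _ hm) (hR _ hm) (norm_nonneg _) hBp
    have h3 := hQ _ hm
    have h4 := norm_add₃_le (a := P (γ t) * f t) (b := P (γ t) * R (γ t)) (c := Q (γ t))
    rw [e]
    have h5 : 0 ≤ Bp * c := by positivity
    have h6 := norm_nonneg (f t)
    calc _ ≤ Bp * ‖f t‖ + c := by rw [hc]; linarith
      _ ≤ a * (‖f t‖ + c) := by rw [ha]; nlinarith
  have hmono : ∀ s ∈ S, ∀ t ∈ S, s ≤ t → ‖γ t - γ s‖ ≤ l t - l s := by
    intro s hs t ht hst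
    have h1 := variationOnFromTo.add hbv h0 hs ht
    have h2 : l t - l s = variationOnFromTo γ S s t := by rw [hl]; linarith
    rw [h2, variationOnFromTo.eq_of_le γ S hst, ← dist_eq_norm]
    rw [← ENNReal.toReal_ofReal (dist_nonneg (x := γ t)), ← edist_dist]
    exact ENNReal.toReal_mono (hbv s t hs ht)
      (eVariationOn.edist_le γ ⟨ht, hst, le_rfl⟩ ⟨hs, le_rfl, hst⟩)
  have hl0 : l 0 = 0 := variationOnFromTo.self γ S 0
  have hlM : ∀ t ∈ S, l t ≤ (eVariationOn γ S).toReal := by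
    intro t ht
    rw [hl, variationOnFromTo.eq_of_le γ S ht.1]
    exact ENNReal.toReal_mono hlen (eVariationOn.mono γ Set.inter_subset_left)
  have hstep : ∀ t ∈ S, ∀ᶠ s in nhdsWithin t S, t ≤ s →
      ‖f s‖ + c ≤ (‖f t‖ + c) * Real.exp (a * (l s - l t)) := by
    intro t ht
    have h1 := (hasDerivAt_iff_isLittleO.1 (hVd t ht)).def (c := 1) one_pos
    have h2 := (hγ t ht).eventually h1
    filter_upwards [h2, self_mem_nhdsWithin] with s hs hsS hts
    have h3 := hmono t ht s hsS hts
    have h4 := hder t ht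
    have h5 : ‖f s - f t‖ ≤ (‖deriv W (γ t) - deriv R (γ t)‖ + 1) * ‖γ s - γ t‖ := by
      have := norm_le_norm_sub_add (f s - f t) ((γ s - γ t) • (deriv W (γ t) - deriv R (γ t)))
      rw [norm_smul] at this
      simp only [f] at this ⊢
      linarith
    have h6 : ‖f s - f t‖ ≤ a * (‖f t‖ + c) * (l s - l t) :=
      h5.trans (mul_le_mul h4 h3 (norm_nonneg _) (by positivity))
    have h7 := norm_le_norm_sub_add (f s) (f t)
    have h8 := Real.add_one_le_exp (a * (l s - l t))
    have h9 : 0 ≤ ‖f t‖ + c := by positivity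
    nlinarith [mul_le_mul_of_nonneg_left h8 h9]
  have key : ∀ t ∈ S, ‖f t‖ + c ≤ (‖f 0‖ + c) * Real.exp (a * l t) := by
    by_contra! hcon
    set B := {t | t ∈ S ∧ (‖f 0‖ + c) * Real.exp (a * l t) < ‖f t‖ + c} with hB
    obtain ⟨t₀, ht₀, ht₀'⟩ := hcon
    have hne : B.Nonempty := ⟨t₀, ht₀, ht₀'⟩
    have hbd : BddBelow B := ⟨0, fun t ht => ht.1.1⟩
    set s := sInf B with hs
    have hsS : s ∈ S := ⟨le_csInf hne fun t ht => ht.1.1, (csInf_le hbd ⟨ht₀, ht₀'⟩).trans_lt ht₀.2⟩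
    have hlt : ∀ r ∈ S, r < s → ‖f r‖ + c ≤ (‖f 0‖ + c) * Real.exp (a * l r) := by
      intro r hr hrs
      by_contra! hh
      exact absurd (csInf_le hbd ⟨hr, hh⟩) (not_le.2 hrs)
    have hgs : ‖f s‖ + c ≤ (‖f 0‖ + c) * Real.exp (a * l s) := by
      rcases hsS.1.eq_or_lt with h | h
      · rw [← h, hl0]; simp
      · have hsub : Set.Ioo 0 s ⊆ S := fun r hr => ⟨hr.1.le, hr.2.trans hsS.2⟩
        have hcont : Filter.Tendsto (fun r => ‖f r‖ + c) (nhdsWithin s (Set.Ioo 0 s))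
            (nhds (‖f s‖ + c)) := (((hfc s hsS).mono hsub).norm.add_const c)
        haveI : (nhdsWithin s (Set.Ioo 0 s)).NeBot := right_nhdsWithin_Ioo_neBot h
        refine le_of_tendsto hcont ?_
        filter_upwards [self_mem_nhdsWithin] with r hr
        refine (hlt r (hsub hr) hr.2).trans ?_
        have := (norm_nonneg _).trans (hmono r (hsub hr) s hsS hr.2.le)
        have h' : l r ≤ l s := by linarith
        gcongr
    obtain ⟨ε, hε, hball⟩ := Metric.mem_nhdsWithin_iff.1 (hstep s hsS)
    obtain ⟨t, htB, htlt⟩ := exists_lt_of_csInf_lt hne (show sInf B < s + ε by linarith)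
    have hst : s ≤ t := csInf_le hbd htB
    have h1 := hball ⟨by rw [Metric.mem_ball, Real.dist_eq, abs_of_nonneg] <;> linarith, htB.1⟩ hst
    have h2 := mul_le_mul_of_nonneg_right hgs (Real.exp_pos (a * (l t - l s))).le
    rw [mul_assoc, ← Real.exp_add, show a * l s + a * (l t - l s) = a * l t by ring] at h2
    exact absurd htB.2 (not_lt.2 (h1.trans h2))
  refine ⟨(‖f 0‖ + c) * Real.exp (a * (eVariationOn γ S).toReal) + Br, ?_⟩
  rintro _ ⟨t, ht, rfl⟩
  have h1 := key t ht
  have h2 : (‖f 0‖ + c) * Real.exp (a * l t) ≤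
      (‖f 0‖ + c) * Real.exp (a * (eVariationOn γ S).toReal) := by
    have := hlM t ht
    gcongr
  have h3 := norm_le_norm_sub_add (W (γ t)) (R (γ t))
  have h4 := hR _ ⟨t, ht, rfl⟩
  simp only [f] at h1 h2 ⊢
  linarith
end

section
/- Consider a system y₁' = F₁(z,y₁,y₂), y₂' = F₂(z,y₁,y₂) where F₁(z,y₁,y₂) = α_{10N}y₂^N + Σ_{j=0}^{M₁} Σ_{k=0}^{N−1} α_{1jk}(z) y₁^j y₂^k and F₂(z,y₁,y₂) = α_{2M0}y₁^M + Σ_{j=0}^{M−1} Σ_{k=0}^{N₂} α_{2jk}(z) y₁^j y₂^k, with N ≥ N₂, M ≥ M₁, constants |α_{10N}| ≥ 1, |α_{2M0}| ≥ 1, all coefficients analytic on the disc D = {|z − a| ≤ R₀} and bounded in modulus there by a constant K > 1. Set C = 2^{N+1}(M+1)(N+1)K, let 0 < Δ < 1 and θ = min{Δ/C, R₀}. If (y₁, y₂) is a solution analytic at a point c with |c − a| < R₀/2 satisfying |y₁(c)| < θ/8 and |y₂(c)| > C, then (y₁, y₂) is analytic on the disc |z − c| < θ/|y₂(c)|^N,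 and on the circle |z − c| = θ/(2|y₂(c)|^N) one has |y₁(z)| ≥ θ/8 and |y₂(z)| ≥ 1. -/
open scoped Topology
open Metric

section picard
variable {E : Type*} [NormedAddCommGroup E] [NormedSpace ℂ E]

lemma ray_hasDerivAt {g g' : ℂ → E} {c w : ℂ} {t : ℝ}
    (hg : HasDerivAt g (g' (c + t * w)) (c + t * w)) :
    HasDerivAt (fun s : ℝ => g (c + s * w)) (w • g' (c + t * w)) t := by
  have h1 : HasDerivAt (fun s : ℝ => c + (s : ℂ) * w) w t := by
    have := ((Complex.ofRealCLM.hasDerivAt (x := t)).mul_const w).const_add c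
    simpa using this
  exact HasDerivAt.scomp t hg h1

lemma ray_mem {c z : ℂ} {ρ t : ℝ} (hz : z ∈ ball c ρ) (h0 : 0 ≤ t) (h1 : t ≤ 1) :
    c + t * (z - c) ∈ ball c ρ := by
  rw [mem_ball, dist_eq_norm] at *
  have : ‖c + t * (z - c) - c‖ = t * ‖z - c‖ := by
    rw [add_sub_cancel_left, norm_mul, Complex.norm_real, Real.norm_of_nonneg h0]
  rw [this]
  nlinarith [norm_nonneg (z - c)]

lemma ray_power {g g' : ℂ → E} {c : ℂ} {ρ A L : ℝ} {n : ℕ}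
    (hg : ∀ z ∈ ball c ρ, HasDerivAt g (g' z) z) (hgc : g c = 0)
    (hb : ∀ z ∈ ball c ρ, ‖g' z‖ ≤ L * (A * (L * ‖z - c‖) ^ n / n.factorial)) :
    ∀ z ∈ ball c ρ, ‖g z‖ ≤ A * (L * ‖z - c‖) ^ (n + 1) / (n + 1).factorial := by
  intro z hz
  set w := z - c with hw
  have key := image_norm_le_of_norm_deriv_right_le_deriv_boundary
    (f := fun s : ℝ => g (c + s * w)) (f' := fun t => w • g' (c + t * w)) (a := 0) (b := 1)
    (B := fun t => A * (L * (t * ‖w‖)) ^ (n + 1) / (n + 1).factorial)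
    (B' := fun t => ‖w‖ * (L * (A * (L * (t * ‖w‖)) ^ n / n.factorial)))
    (fun t ht => (ray_hasDerivAt (hg _ (ray_mem hz ht.1 ht.2))).continuousAt.continuousWithinAt)
    (fun t ht => (ray_hasDerivAt (hg _ (ray_mem hz ht.1 ht.2.le))).hasDerivWithinAt)
    (by simp [hgc])
    (by
      intro t
      have h : HasDerivAt (fun t : ℝ => L * (t * ‖w‖)) (L * ‖w‖) t := by
        simpa using ((hasDerivAt_id t).mul_const ‖w‖).const_mul L
      have h2 := ((h.pow (n + 1)).const_mul A).div_const ((n + 1).factorial : ℝ)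
      refine h2.congr_deriv ?_
      have : (n.factorial : ℝ) ≠ 0 := by positivity
      rw [Nat.factorial_succ]
      push_cast
      have : (n + 1 : ℝ) ≠ 0 := by positivity
      field_simp)
    (by
      intro t ht
      rw [norm_smul]
      refine mul_le_mul_of_nonneg_left ?_ (norm_nonneg _)
      have := hb _ (ray_mem hz ht.1 ht.2.le)
      rwa [add_sub_cancel_left, norm_mul, Complex.norm_real, Real.norm_of_nonneg ht.1] at this)
  have := key (x := 1) (by simp)
  simpa [hw] using this

lemma picard_step [CompleteSpace E] {f : ℂ → E → E} {c : ℂ} {y0 : E} {ρ r m : ℝ}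
    (hρ : 0 < ρ) 
    (hd : ∀ z ∈ ball c ρ, ∀ y ∈ closedBall y0 r,
      DifferentiableAt ℂ (fun p : ℂ × E => f p.1 p.2) (z, y))
    (hm : ∀ z ∈ ball c ρ, ∀ y ∈ closedBall y0 r, ‖f z y‖ ≤ m) (hmρ : m * ρ ≤ r)
    (Y : ℂ → E) (hY : DifferentiableOn ℂ Y (ball c ρ))
    (hYb : ∀ z ∈ ball c ρ, Y z ∈ closedBall y0 r) :
    ∃ P : ℂ → E, P c = y0 ∧ (∀ z ∈ ball c ρ, HasDerivAt P (f z (Y z)) z) ∧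
      DifferentiableOn ℂ P (ball c ρ) ∧ ∀ z ∈ ball c ρ, P z ∈ closedBall y0 r := by
  have hD : DifferentiableOn ℂ (fun z => f z (Y z)) (ball c ρ) := by
    intro z hz
    have h1 := (hY z hz).differentiableAt (isOpen_ball.mem_nhds hz)
    have h2 : DifferentiableAt ℂ (fun z => (z, Y z)) z := differentiableAt_id.prodMk h1
    exact (DifferentiableAt.comp z (hd z hz _ (hYb z hz)) h2).differentiableWithinAt
  obtain ⟨P, hPc, hP⟩ := hD.isExactOn_ball.with_val_at c y0
  refine ⟨P, hPc, hP, fun z hz => (hP z hz).differentiableAt.differentiableWithinAt, ?_⟩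
  intro z hz
  have hc : c ∈ ball c ρ := mem_ball_self hρ
  have h := (convex_ball c ρ).norm_image_sub_le_of_norm_hasDerivWithin_le (f := P)
    (fun x hx => (hP x hx).hasDerivWithinAt) (fun x hx => hm x hx _ (hYb x hx)) hc hz
  rw [hPc] at h
  rw [mem_closedBall, dist_eq_norm]
  have hm0 : 0 ≤ m := (norm_nonneg _).trans (hm c hc _ (hYb c hc))
  rw [mem_ball, dist_eq_norm] at hz
  nlinarith

lemma picard [CompleteSpace E] {f : ℂ → E → E} {c : ℂ} {y0 : E} {ρ r m L : ℝ}
    (hρ : 0 < ρ) (hr : 0 ≤ r) (hL0 : 0 ≤ L)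
    (hd : ∀ z ∈ ball c ρ, ∀ y ∈ closedBall y0 r,
      DifferentiableAt ℂ (fun p : ℂ × E => f p.1 p.2) (z, y))
    (hm : ∀ z ∈ ball c ρ, ∀ y ∈ closedBall y0 r, ‖f z y‖ ≤ m) (hmρ : m * ρ ≤ r)
    (hL : ∀ z ∈ ball c ρ, ∀ y ∈ closedBall y0 r, ∀ y' ∈ closedBall y0 r,
      ‖f z y - f z y'‖ ≤ L * ‖y - y'‖) :
    ∃ Y : ℂ → E, Y c = y0 ∧ (∀ z ∈ ball c ρ, Y z ∈ closedBall y0 r) ∧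
      ∀ z ∈ ball c ρ, HasDerivAt Y (f z (Y z)) z := by
  have hc : c ∈ ball c ρ := mem_ball_self hρ
  let X := {Y : ℂ → E // DifferentiableOn ℂ Y (ball c ρ) ∧
    ∀ z ∈ ball c ρ, Y z ∈ closedBall y0 r}
  choose P hPc hPd hPD hPb using fun Y : X => picard_step hρ hd hm hmρ Y.1 Y.2.1 Y.2.2
  let T : X → X := fun Y => ⟨P Y, hPD Y, hPb Y⟩
  let u0 : X := ⟨fun _ => y0, by fun_prop, fun z _ => mem_closedBall_self hr⟩
  let u : ℕ → X := fun n => T^[n] u0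
  have hu : ∀ n, u (n + 1) = T (u n) := fun n => Function.iterate_succ_apply' T n u0
  have huc : ∀ n, (u n).1 c = y0 := by
    intro n
    cases n with
    | zero => rfl
    | succ n => rw [hu]; exact hPc _
  have hud : ∀ n, ∀ z ∈ ball c ρ, HasDerivAt (u (n + 1)).1 (f z ((u n).1 z)) z := by
    intro n; rw [hu]; exact hPd _
  have hdiff : ∀ n, ∀ z ∈ ball c ρ,
      ‖(u (n + 1)).1 z - (u n).1 z‖ ≤ r * (L * ‖z - c‖) ^ n / n.factorial := by
    intro n
    induction n with
    | zero =>
      intro z hz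
      have := (u 1).2.2 z hz
      rw [mem_closedBall, dist_eq_norm] at this
      change ‖(u 1).1 z - y0‖ ≤ _
      simpa using this
    | succ n ih =>
      refine ray_power (g := fun z => (u (n + 2)).1 z - (u (n + 1)).1 z)
        (g' := fun z => f z ((u (n + 1)).1 z) - f z ((u n).1 z))
        (fun z hz => (hud (n + 1) z hz).sub (hud n z hz)) (by simp [huc]) ?_
      intro z hz
      exact (hL z hz _ ((u (n+1)).2.2 z hz) _ ((u n).2.2 z hz)).trans
        (mul_le_mul_of_nonneg_left (ih z hz) hL0)
  have hsum : Summable (fun n : ℕ => r * ((L * ρ) ^ n / n.factorial)) :=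
    (Real.summable_pow_div_factorial (L * ρ)).mul_left r
  have hunif := tendstoUniformlyOn_tsum_nat (f := fun n z => (u (n + 1)).1 z - (u n).1 z)
    (s := ball c ρ) hsum (by
      intro n z hz
      refine (hdiff n z hz).trans ?_
      rw [mul_div_assoc]
      have : ‖z - c‖ ≤ ρ := by rw [mem_ball, dist_eq_norm] at hz; exact hz.le
      gcongr)
  set S : ℂ → E := fun z => ∑' n, ((u (n + 1)).1 z - (u n).1 z) with hS
  have hps : (fun (N : ℕ) z => ∑ n ∈ Finset.range N, ((u (n + 1)).1 z - (u n).1 z)) =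
      fun N z => (u N).1 z - y0 := by
    funext N z
    rw [Finset.sum_range_sub (fun n => (u n).1 z)]
    rfl
  rw [hps] at hunif
  have hloc := hunif.tendstoLocallyUniformlyOn
  have hF : ∀ᶠ n in Filter.atTop, DifferentiableOn ℂ (fun z => (u n).1 z - y0) (ball c ρ) :=
    Filter.Eventually.of_forall fun n => (u n).2.1.sub_const y0
  have hSd := hloc.differentiableOn hF isOpen_ball
  have hder := hloc.deriv hF isOpen_ball
  have hpt : ∀ z ∈ ball c ρ, Filter.Tendsto (fun n => (u n).1 z) Filter.atTop (𝓝 (S z + y0)) := by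
    intro z hz
    have := (hunif.tendsto_at hz).add_const y0
    simpa using this
  have hmem : ∀ z ∈ ball c ρ, S z + y0 ∈ closedBall y0 r := fun z hz =>
    isClosed_closedBall.mem_of_tendsto (hpt z hz) (Filter.Eventually.of_forall fun n =>
      (u n).2.2 z hz)
  refine ⟨fun z => S z + y0, ?_, hmem, ?_⟩
  · exact tendsto_nhds_unique (hpt c hc) (by simp [huc])
  · intro z hz
    have h1 : HasDerivAt (fun z => S z + y0) (deriv S z) z :=
      ((hSd z hz).differentiableAt (isOpen_ball.mem_nhds hz)).hasDerivAt.add_const y0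
    have h2 : Filter.Tendsto (fun n => deriv (fun z => (u (n+1)).1 z - y0) z) Filter.atTop
        (𝓝 (deriv S z)) := (hder.tendsto_at hz).comp (Filter.tendsto_add_atTop_nat 1)
    have h3 : (fun n => deriv (fun z => (u (n+1)).1 z - y0) z) = fun n => f z ((u n).1 z) := by
      funext n
      exact ((hud n z hz).sub_const y0).deriv
    rw [h3] at h2
    have h4 : Filter.Tendsto (fun n => f z ((u n).1 z)) Filter.atTop (𝓝 (f z (S z + y0))) := by
      have h5 := (hd z hz _ (hmem z hz)).continuousAt
      exact Filter.Tendsto.comp (f := fun n => (z, (u n).1 z)) h5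
        (tendsto_const_nhds.prodMk_nhds (hpt z hz))
    rw [tendsto_nhds_unique h2 h4] at h1
    exact h1

lemma ode_unique {f : ℂ → E → E} {c : ℂ} {s : Set E} {ρ L : ℝ}
    (hL : ∀ z ∈ ball c ρ, ∀ y ∈ s, ∀ y' ∈ s, ‖f z y - f z y'‖ ≤ L * ‖y - y'‖)
    {Y Z : ℂ → E} (hYs : ∀ z ∈ ball c ρ, Y z ∈ s) (hZs : ∀ z ∈ ball c ρ, Z z ∈ s)
    (hY : ∀ z ∈ ball c ρ, HasDerivAt Y (f z (Y z)) z)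
    (hZ : ∀ z ∈ ball c ρ, HasDerivAt Z (f z (Z z)) z) (h0 : Y c = Z c) :
    ∀ z ∈ ball c ρ, Y z = Z z := by
  intro z hz
  set w := z - c with hw
  have hd : ∀ x ∈ ball c ρ, HasDerivAt (fun x => Y x - Z x) (f x (Y x) - f x (Z x)) x :=
    fun x hx => (hY x hx).sub (hZ x hx)
  have key := norm_le_gronwallBound_of_norm_deriv_right_le
    (f := fun s : ℝ => Y (c + s * w) - Z (c + s * w))
    (f' := fun t => w • (f (c + t * w) (Y (c + t * w)) - f (c + t * w) (Z (c + t * w))))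
    (a := 0) (b := 1) (δ := 0) (K := ‖w‖ * L) (ε := 0)
    (fun t ht => (ray_hasDerivAt (g' := fun x => f x (Y x) - f x (Z x))
      (hd _ (ray_mem hz ht.1 ht.2))).continuousAt.continuousWithinAt)
    (fun t ht => (ray_hasDerivAt (g' := fun x => f x (Y x) - f x (Z x))
      (hd _ (ray_mem hz ht.1 ht.2.le))).hasDerivWithinAt)
    (by simp [h0])
    (by
      intro t ht
      have hm := ray_mem hz ht.1 ht.2.le
      rw [norm_smul, add_zero, mul_assoc]
      exact mul_le_mul_of_nonneg_left (hL _ hm _ (hYs _ hm) _ (hZs _ hm)) (norm_nonneg _))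
    1 (by simp)
  simp [hw, gronwallBound_ε0] at key
  exact sub_eq_zero.1 key

end picard

lemma dsum_bound (α : ℕ × ℕ → ℂ → ℂ) (J n : ℕ) (z x y : ℂ) (K Q : ℝ) (hK : 0 ≤ K)
    (hα : ∀ j ∈ Finset.range J, ∀ k ∈ Finset.range n, ‖α (j, k) z‖ ≤ K)
    (hx : ‖x‖ ≤ 1) (hQ : ∀ k ∈ Finset.range n, ‖y‖ ^ k ≤ Q) :
    ‖∑ j ∈ Finset.range J, ∑ k ∈ Finset.range n, α (j, k) z * x ^ j * y ^ k‖ ≤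
      J * (n * (K * Q)) := by
  have h := norm_sum_le_of_le (Finset.range J)
    (f := fun j => ∑ k ∈ Finset.range n, α (j, k) z * x ^ j * y ^ k)
    (n := fun _ => (n : ℝ) * (K * Q)) ?_
  · simpa using h
  intro j hj
  have h := norm_sum_le_of_le (Finset.range n)
    (f := fun k => α (j, k) z * x ^ j * y ^ k)
    (n := fun _ => (K * Q)) ?_
  · simpa using h
  intro k hk
  rw [norm_mul, norm_mul, norm_pow, norm_pow]
  have h1 : ‖x‖ ^ j ≤ 1 := pow_le_one₀ (norm_nonneg _) hx
  have h2 := hα j hj k hk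
  have h3 := hQ k hk
  calc ‖α (j, k) z‖ * ‖x‖ ^ j * ‖y‖ ^ k ≤ K * 1 * Q := by gcongr
    _ = K * Q := by ring

lemma dsum_analytic (α : ℕ × ℕ → ℂ → ℂ) (J n : ℕ) (A : ℂ) (N : ℕ) (p₀ : ℂ × ℂ × ℂ)
    (pr : ℂ × ℂ → ℂ) (hpr : AnalyticAt ℂ pr p₀.2)
    (hα : ∀ j ∈ Finset.range J, ∀ k ∈ Finset.range n, AnalyticAt ℂ (α (j, k)) p₀.1) :
    AnalyticAt ℂ (fun p : ℂ × ℂ × ℂ => A * pr p.2 ^ N +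
      ∑ j ∈ Finset.range J, ∑ k ∈ Finset.range n, α (j, k) p.1 * p.2.1 ^ j * p.2.2 ^ k) p₀ := by
  have e1 : AnalyticAt ℂ (fun p : ℂ × ℂ × ℂ => p.1) p₀ := analyticAt_fst
  have e2 : AnalyticAt ℂ (fun p : ℂ × ℂ × ℂ => p.2) p₀ := analyticAt_snd
  have e3 : AnalyticAt ℂ (fun p : ℂ × ℂ × ℂ => p.2.1) p₀ := analyticAt_fst.comp e2
  have e4 : AnalyticAt ℂ (fun p : ℂ × ℂ × ℂ => p.2.2) p₀ := analyticAt_snd.comp e2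
  refine (analyticAt_const.mul ((hpr.comp e2).pow N)).add ?_
  refine Finset.analyticAt_fun_sum _ fun j hj => Finset.analyticAt_fun_sum _ fun k hk => ?_
  exact (((hα j hj k hk).comp e1).mul (e3.pow j)).mul (e4.pow k)

lemma pow_sub_bound (x y : ℂ) (n : ℕ) (R δ : ℝ) (hx : ‖x‖ ≤ R) (hy : ‖y‖ ≤ R)
    (hδ : ‖x - y‖ ≤ δ) : ‖x ^ n - y ^ n‖ ≤ n * R ^ (n - 1) * δ := by
  have h := (convex_closedBall (0 : ℂ) R).norm_image_sub_le_of_norm_hasDerivWithin_le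
    (f := fun x : ℂ => x ^ n) (f' := fun x => n * x ^ (n - 1)) (C := n * R ^ (n - 1))
    (fun x _ => (hasDerivAt_pow n x).hasDerivWithinAt) (by
      intro w hw
      rw [mem_closedBall, dist_zero_right] at hw
      rw [norm_mul, norm_pow, Complex.norm_natCast]
      gcongr) (x := y) (y := x) (by simpa using hy) (by simpa using hx)
  have hR : 0 ≤ R := (norm_nonneg _).trans hx
  exact h.trans (by gcongr)

set_option maxHeartbeats 2000000 in
/-- Circle lemma: for the system `y₁' = F₁(z,y₁,y₂)`, `y₂' = F₂(z,y₁,y₂)` with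
dominant terms `A₁·y₂^N` and `A₂·y₁^M` (constant leading coefficients of modulus at
least 1) and all coefficients analytic on `D = {|z−a| ≤ R₀}` and bounded there by
`K > 1`, set `C = 2^(N+1)(M+1)(N+1)K`, `θ = min (Δ/C) R₀` for `0 < Δ < 1`.  If a
solution is analytic at `c` with `|c−a| < R₀/2`, `|y₁(c)| < θ/8` and `|y₂(c)| > C`,
then it extends analytically to the disc `|z−c| < θ/|y₂(c)|^N`, and on the circle
`|z−c| = θ/(2|y₂(c)|^N)` one has `|y₁| ≥ θ/8` and `|y₂| ≥ 1`. -/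
theorem circle_lemma (M N M₁ N₂ : ℕ) (hM : 0 < M) (hN : 0 < N)
    (hN₂ : N₂ ≤ N) (hM₁ : M₁ ≤ M)
    (a : ℂ) (R₀ : ℝ) (hR₀ : 0 < R₀)
    (A₁ A₂ : ℂ) (hA₁ : 1 ≤ ‖A₁‖) (hA₂ : 1 ≤ ‖A₂‖)
    (α₁ α₂ : ℕ × ℕ → ℂ → ℂ)
    (hα₁ : ∀ j ∈ Finset.range (M₁ + 1), ∀ k ∈ Finset.range N,
      AnalyticOnNhd ℂ (α₁ (j, k)) (closedBall a R₀))
    (hα₂ : ∀ j ∈ Finset.range M, ∀ k ∈ Finset.range (N₂ + 1),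
      AnalyticOnNhd ℂ (α₂ (j, k)) (closedBall a R₀))
    (K : ℝ) (hK : 1 < K) (hA₁K : ‖A₁‖ < K) (hA₂K : ‖A₂‖ < K)
    (hα₁K : ∀ j ∈ Finset.range (M₁ + 1), ∀ k ∈ Finset.range N,
      ∀ z ∈ closedBall a R₀, ‖α₁ (j, k) z‖ < K)
    (hα₂K : ∀ j ∈ Finset.range M, ∀ k ∈ Finset.range (N₂ + 1),
      ∀ z ∈ closedBall a R₀, ‖α₂ (j, k) z‖ < K)
    (Δ : ℝ) (hΔ0 : 0 < Δ) (hΔ1 : Δ < 1)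
    (c : ℂ) (hc : ‖c - a‖ < R₀ / 2)
    (U : Set ℂ) (hU : IsOpen U) (hcU : c ∈ U)
    (y₁ y₂ : ℂ → ℂ) (hy₁ : AnalyticOnNhd ℂ y₁ U) (hy₂ : AnalyticOnNhd ℂ y₂ U)
    (hode : ∀ z ∈ U,
      deriv y₁ z = A₁ * y₂ z ^ N +
          ∑ j ∈ Finset.range (M₁ + 1), ∑ k ∈ Finset.range N,
            α₁ (j, k) z * y₁ z ^ j * y₂ z ^ k ∧
      deriv y₂ z = A₂ * y₁ z ^ M +
          ∑ j ∈ Finset.range M, ∑ k ∈ Finset.range (N₂ + 1),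
            α₂ (j, k) z * y₁ z ^ j * y₂ z ^ k)
    (hy₁c : ‖y₁ c‖ <
      min (Δ / (2 ^ (N + 1) * (M + 1) * (N + 1) * K)) R₀ / 8)
    (hy₂c : ‖y₂ c‖ > 2 ^ (N + 1) * (M + 1) * (N + 1) * K) :
    ∃ Y₁ Y₂ : ℂ → ℂ,
      AnalyticOnNhd ℂ Y₁
        (ball c (min (Δ / (2 ^ (N + 1) * (M + 1) * (N + 1) * K)) R₀ / ‖y₂ c‖ ^ N)) ∧
      AnalyticOnNhd ℂ Y₂
        (ball c (min (Δ / (2 ^ (N + 1) * (M + 1) * (N + 1) * K)) R₀ / ‖y₂ c‖ ^ N)) ∧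
      (∀ z ∈ ball c (min (Δ / (2 ^ (N + 1) * (M + 1) * (N + 1) * K)) R₀ / ‖y₂ c‖ ^ N),
        deriv Y₁ z = A₁ * Y₂ z ^ N +
            ∑ j ∈ Finset.range (M₁ + 1), ∑ k ∈ Finset.range N,
              α₁ (j, k) z * Y₁ z ^ j * Y₂ z ^ k ∧
        deriv Y₂ z = A₂ * Y₁ z ^ M +
            ∑ j ∈ Finset.range M, ∑ k ∈ Finset.range (N₂ + 1),
              α₂ (j, k) z * Y₁ z ^ j * Y₂ z ^ k) ∧
      (∀ᶠ z in 𝓝 c, Y₁ z = y₁ z ∧ Y₂ z = y₂ z) ∧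
      ∀ z : ℂ,
        ‖z - c‖ = min (Δ / (2 ^ (N + 1) * (M + 1) * (N + 1) * K)) R₀ / (2 * ‖y₂ c‖ ^ N) →
        min (Δ / (2 ^ (N + 1) * (M + 1) * (N + 1) * K)) R₀ / 8 ≤ ‖Y₁ z‖ ∧ 1 ≤ ‖Y₂ z‖ := by
  set C : ℝ := 2 ^ (N + 1) * (M + 1) * (N + 1) * K with hC
  set θ : ℝ := min (Δ / C) R₀ with hθ
  set B : ℝ := ‖y₂ c‖ with hB
  have hMr : (1 : ℝ) ≤ M := by exact_mod_cast hM
  have hNr : (1 : ℝ) ≤ N := by exact_mod_cast hN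
  have hM₁r : (M₁ : ℝ) ≤ M := by exact_mod_cast hM₁
  have hN₂r : (N₂ : ℝ) ≤ N := by exact_mod_cast hN₂
  have hK0 : 0 < K := by linarith
  have hC4 : 4 ≤ C := by
    have h1 : (2 : ℝ) ≤ 2 ^ (N + 1) := by
      rw [pow_succ]; nlinarith [one_le_pow₀ (M₀ := ℝ) (a := 2) (n := N) (by norm_num)]
    calc (4 : ℝ) ≤ 2 * (1 + 1) * (1 + 1) * 1 := by norm_num
      _ ≤ C := by rw [hC]; gcongr
  have hB4 : 4 ≤ B := by linarith
  have hC0 : 0 < C := by linarith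
  have hB0 : 0 < B := by linarith
  have hθ0 : 0 < θ := lt_min (div_pos hΔ0 hC0) hR₀
  have hθR : θ ≤ R₀ := min_le_right _ _
  have hCθ : C * θ ≤ 1 := by
    have : θ ≤ Δ / C := min_le_left _ _
    rw [le_div_iff₀ hC0] at this
    linarith
  have hθ1 : θ ≤ 1 := by nlinarith
  have hBN : B ≤ B ^ N := le_self_pow₀ (by linarith) hN.ne'
  have hBN0 : 0 < B ^ N := by positivity
  set ρ : ℝ := θ / B ^ N with hρ
  have hρ0 : 0 < ρ := by positivity
  have hρB : ρ * B ^ N = θ := by rw [hρ]; field_simp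
  have hρR : ρ ≤ R₀ / 2 := by nlinarith
  have hsub : closedBall c ρ ⊆ closedBall a R₀ := by
    intro z hz
    rw [mem_closedBall, dist_eq_norm] at *
    calc ‖z - a‖ = ‖(z - c) + (c - a)‖ := by ring_nf
      _ ≤ ‖z - c‖ + ‖c - a‖ := norm_add_le _ _
      _ ≤ R₀ := by linarith
  have hsubb : ball c ρ ⊆ closedBall a R₀ := ball_subset_closedBall.trans hsub
  let f : ℂ → ℂ × ℂ → ℂ × ℂ := fun z p =>
    (A₁ * p.2 ^ N + ∑ j ∈ Finset.range (M₁ + 1), ∑ k ∈ Finset.range N,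
            α₁ (j, k) z * p.1 ^ j * p.2 ^ k,
     A₂ * p.1 ^ M + ∑ j ∈ Finset.range M, ∑ k ∈ Finset.range (N₂ + 1),
            α₂ (j, k) z * p.1 ^ j * p.2 ^ k)
  set y0 : ℂ × ℂ := (y₁ c, y₂ c) with hy0
  have hbox : ∀ p ∈ closedBall y0 (1/2), ‖p.1‖ ≤ 1 ∧ ‖p.2‖ ≤ 2 * B ∧ ‖p.2 - y₂ c‖ ≤ 1 / 2 := by
    intro p hp
    rw [mem_closedBall, dist_eq_norm] at hp
    have h1 : ‖p.1 - y₁ c‖ ≤ 1 / 2 := (norm_fst_le (p - y0)).trans hp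
    have h2 : ‖p.2 - y₂ c‖ ≤ 1 / 2 := (norm_snd_le (p - y0)).trans hp
    have h3 := norm_le_norm_add_norm_sub' p.1 (y₁ c)
    have h4 := norm_le_norm_add_norm_sub' p.2 (y₂ c)
    refine ⟨by linarith, by linarith, h2⟩
  have hpow : ∀ y : ℂ, ‖y‖ ≤ 2 * B → ∀ k n : ℕ, k ≤ n → ‖y‖ ^ k ≤ (2 * B) ^ n := by
    intro y hy k n hkn
    calc ‖y‖ ^ k ≤ (2 * B) ^ k := by gcongr
      _ ≤ (2 * B) ^ n := pow_le_pow_right₀ (by linarith) hkn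
  have hlow : ∀ z ∈ ball c ρ, ∀ p ∈ closedBall y0 (1/2),
      ‖∑ j ∈ Finset.range (M₁ + 1), ∑ k ∈ Finset.range N, α₁ (j, k) z * p.1 ^ j * p.2 ^ k‖ ≤
        (M + 1) * (N * (K * (2 * B) ^ (N - 1))) := by
    intro z hz p hp
    obtain ⟨h1, h2, -⟩ := hbox p hp
    refine (dsum_bound α₁ (M₁ + 1) N z p.1 p.2 K ((2 * B) ^ (N - 1)) hK0.le
      (fun j hj k hk => (hα₁K j hj k hk z (hsubb hz)).le) h1
      (fun k hk => hpow _ h2 _ _ (by have := Finset.mem_range.1 hk; omega))).trans ?_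
    push_cast
    gcongr
  have hPP : (2 * B) ^ (N - 1) ≤ (2 * B) ^ N := pow_le_pow_right₀ (by linarith) (by omega)
  have hP1 : 1 ≤ (2 * B) ^ N := one_le_pow₀ (by linarith)
  have hP0 : 0 < (2 * B) ^ (N - 1) := by positivity
  have hCB : C / 2 * B ^ N = (M + 1) * (N + 1) * (K * (2 * B) ^ N) := by
    rw [hC, mul_pow, pow_succ]; ring
  have hm : ∀ z ∈ ball c ρ, ∀ p ∈ closedBall y0 (1/2), ‖f z p‖ ≤ C / 2 * B ^ N := by
    intro z hz p hp
    obtain ⟨h1, h2, -⟩ := hbox p hp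
    rw [hCB]
    refine norm_prod_le_iff.2 ⟨?_, ?_⟩
    · refine (norm_add_le _ _).trans ((add_le_add_right (hlow z hz p hp) _).trans ?_)
      rw [norm_mul, norm_pow]
      have h3 : ‖A₁‖ * ‖p.2‖ ^ N ≤ K * (2 * B) ^ N :=
        mul_le_mul hA₁K.le (hpow _ h2 N N le_rfl) (by positivity) hK0.le
      have h4 : ((M : ℝ) + 1) * (N * (K * (2 * B) ^ (N - 1))) ≤ (M + 1) * (N * (K * (2 * B) ^ N)) := by
        gcongr
      have h5 : 0 ≤ M * (K * (2 * B) ^ N) := by positivity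
      have h7 : ((M : ℝ) + 1) * (N + 1) * (K * (2 * B) ^ N) = (M + 1) * (N * (K * (2 * B) ^ N)) +
          M * (K * (2 * B) ^ N) + K * (2 * B) ^ N := by ring
      linarith
    · have h6 := dsum_bound α₂ M (N₂ + 1) z p.1 p.2 K ((2 * B) ^ N) hK0.le
        (fun j hj k hk => (hα₂K j hj k hk z (hsubb hz)).le) h1
        (fun k hk => hpow _ h2 _ _ (by have := Finset.mem_range.1 hk; omega))
      refine (norm_add_le _ _).trans ((add_le_add_right h6 _).trans ?_)
      rw [norm_mul, norm_pow]
      have h3 : ‖A₂‖ * ‖p.1‖ ^ M ≤ K * (2 * B) ^ N :=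
        mul_le_mul hA₂K.le ((pow_le_one₀ (norm_nonneg _) h1).trans hP1) (by positivity) hK0.le
      have h4 : (M : ℝ) * (((N₂ + 1 : ℕ) : ℝ) * (K * (2 * B) ^ N)) ≤
          M * ((N + 1) * (K * (2 * B) ^ N)) := by
        push_cast
        gcongr
      have h5 : 0 ≤ N * (K * (2 * B) ^ N) := by positivity
      have h7 : ((M : ℝ) + 1) * (N + 1) * (K * (2 * B) ^ N) = M * ((N + 1) * (K * (2 * B) ^ N)) +
          N * (K * (2 * B) ^ N) + K * (2 * B) ^ N := by ring
      linarith
  have hmρ : C / 2 * B ^ N * ρ ≤ 1 / 2 := by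
    have : C / 2 * B ^ N * ρ = C * θ / 2 := by rw [← hρB]; ring
    linarith
  have hfan : ∀ z ∈ closedBall c ρ, ∀ p : ℂ × ℂ,
      AnalyticAt ℂ (fun q : ℂ × ℂ × ℂ => f q.1 q.2) (z, p) := by
    intro z hz p
    exact (dsum_analytic α₁ (M₁ + 1) N A₁ N (z, p) Prod.snd analyticAt_snd
      (fun j hj k hk => hα₁ j hj k hk z (hsub hz))).prod
      (dsum_analytic α₂ M (N₂ + 1) A₂ M (z, p) Prod.fst analyticAt_fst
      (fun j hj k hk => hα₂ j hj k hk z (hsub hz)))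
  obtain ⟨L, hL⟩ : ∃ L : NNReal, LipschitzOnWith L (fun q : ℂ × ℂ × ℂ => f q.1 q.2)
      (closedBall c ρ ×ˢ closedBall y0 (1/2)) := by
    refine ContDiffOn.exists_lipschitzOnWith (n := 1) ?_ one_ne_zero
      ((convex_closedBall _ _).prod (convex_closedBall _ _))
      ((isCompact_closedBall _ _).prod (isCompact_closedBall _ _))
    rintro ⟨z, p⟩ ⟨hz, -⟩
    exact ((hfan z hz p).contDiffAt.restrict_scalars ℝ).contDiffWithinAt
  have hLip : ∀ z ∈ ball c ρ, ∀ y ∈ closedBall y0 (1/2), ∀ y' ∈ closedBall y0 (1/2),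
      ‖f z y - f z y'‖ ≤ L * ‖y - y'‖ := by
    intro z hz y hy y' hy'
    have := hL.dist_le_mul (z, y) ⟨ball_subset_closedBall hz, hy⟩
      (z, y') ⟨ball_subset_closedBall hz, hy'⟩
    simpa [Prod.dist_eq, dist_eq_norm] using this
  obtain ⟨Y, hYc, hYb, hYd⟩ := picard (f := f) hρ0 (by norm_num : (0 : ℝ) ≤ 1 / 2) L.2
    (fun z hz p _ => (hfan z (ball_subset_closedBall hz) p).differentiableAt) hm hmρ hLip
  have hY1 : ∀ z ∈ ball c ρ, HasDerivAt (fun z => (Y z).1) (f z (Y z)).1 z := fun z hz =>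
    (hYd z hz).fst
  have hY2 : ∀ z ∈ ball c ρ, HasDerivAt (fun z => (Y z).2) (f z (Y z)).2 z := fun z hz =>
    (hYd z hz).snd
  refine ⟨fun z => (Y z).1, fun z => (Y z).2, ?_, ?_, ?_, ?_, ?_⟩
  · exact DifferentiableOn.analyticOnNhd
      (fun z hz => (hY1 z hz).differentiableAt.differentiableWithinAt) isOpen_ball
  · exact DifferentiableOn.analyticOnNhd
      (fun z hz => (hY2 z hz).differentiableAt.differentiableWithinAt) isOpen_ball
  · exact fun z hz => ⟨(hY1 z hz).deriv, (hY2 z hz).deriv⟩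
  · have hyd : ∀ z ∈ U, HasDerivAt (fun z => (y₁ z, y₂ z)) (f z (y₁ z, y₂ z)) z := by
      intro z hz
      have h1 := (hy₁ z hz).differentiableAt.hasDerivAt
      have h2 := (hy₂ z hz).differentiableAt.hasDerivAt
      rw [(hode z hz).1] at h1
      rw [(hode z hz).2] at h2
      exact h1.prodMk h2
    have hnear : ∀ᶠ z in 𝓝 c, z ∈ ball c ρ ∧ z ∈ U ∧ (y₁ z, y₂ z) ∈ closedBall y0 (1/2) := by
      filter_upwards [ball_mem_nhds c hρ0, hU.mem_nhds hcU,
        (hyd c hcU).continuousAt.preimage_mem_nhds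
          (closedBall_mem_nhds y0 (by norm_num : (0 : ℝ) < 1 / 2))] with z h1 h2 h3
      exact ⟨h1, h2, h3⟩
    obtain ⟨ε, hε, hball⟩ := Metric.eventually_nhds_iff_ball.1 hnear
    have huniq := ode_unique (f := f) (c := c) (ρ := ε) (L := L) (s := closedBall y0 (1/2))
      (Y := Y) (Z := fun z => (y₁ z, y₂ z))
      (fun z hz => hLip z (hball z hz).1) (fun z hz => hYb z (hball z hz).1)
      (fun z hz => (hball z hz).2.2) (fun z hz => hYd z (hball z hz).1)
      (fun z hz => hyd z (hball z hz).2.1) hYc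
    filter_upwards [ball_mem_nhds c hε] with z hz
    have := huniq z hz
    exact ⟨congrArg Prod.fst this, congrArg Prod.snd this⟩
  · intro z hz
    have hzρ : ‖z - c‖ = ρ / 2 := by rw [hz, hρ]; field_simp
    have hzb : z ∈ ball c ρ := by rw [mem_ball, dist_eq_norm, hzρ]; linarith
    refine ⟨?_, ?_⟩
    · have hmain : ∀ w ∈ ball c ρ, ‖(f w (Y w)).1 - A₁ * y₂ c ^ N‖ ≤ B ^ N / 2 := by
        intro w hw
        obtain ⟨-, h2, h3⟩ := hbox _ (hYb w hw)
        have h4 := hlow w hw _ (hYb w hw)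
        have h5 := pow_sub_bound (Y w).2 (y₂ c) N (2 * B) (1 / 2) h2 (by linarith) h3
        have h6 : (f w (Y w)).1 - A₁ * y₂ c ^ N = A₁ * ((Y w).2 ^ N - y₂ c ^ N) +
            ∑ j ∈ Finset.range (M₁ + 1), ∑ k ∈ Finset.range N,
              α₁ (j, k) w * (Y w).1 ^ j * (Y w).2 ^ k := by
          simp only [f]; ring
        rw [h6]
        refine (norm_add_le _ _).trans ?_
        rw [norm_mul]
        have h7 : ‖A₁‖ * ‖(Y w).2 ^ N - y₂ c ^ N‖ ≤ K * (N * (2 * B) ^ (N - 1) * (1 / 2)) := by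
          gcongr
        have h8 : 2 * ((M + 1) * (N + 1) * (K * (2 * B) ^ (N - 1))) ≤ B ^ N / 2 := by
          obtain ⟨n, rfl⟩ : ∃ n, N = n + 1 := ⟨N - 1, by omega⟩
          have : 2 * (((M : ℝ) + 1) * (((n + 1 : ℕ) : ℝ) + 1) * (K * (2 * B) ^ (n + 1 - 1))) =
              C * B ^ n / 2 := by
            rw [hC, Nat.add_sub_cancel, mul_pow]; ring
          rw [this, pow_succ]
          have : 0 < B ^ n := by positivity
          nlinarith
        have h9 : 0 ≤ K * (2 * B) ^ (N - 1) := by positivity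
        have h10 : 0 ≤ M * (K * (2 * B) ^ (N - 1)) := by positivity
        have h11 : 0 ≤ N * (K * (2 * B) ^ (N - 1)) := by positivity
        have h12 : 0 ≤ M * (N * (K * (2 * B) ^ (N - 1))) := by positivity
        refine (add_le_add h7 h4).trans ?_
        ring_nf at h8 h9 h10 h11 h12 ⊢
        linarith
      have h := (convex_ball c ρ).norm_image_sub_le_of_norm_hasDerivWithin_le
        (f := fun w => (Y w).1 - A₁ * y₂ c ^ N * w)
        (fun w hw => ((hY1 w hw).sub
          (by simpa using (hasDerivAt_id w).const_mul (A₁ * y₂ c ^ N))).hasDerivWithinAt)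
        hmain (mem_ball_self hρ0) hzb
      have hYc1 : (Y c).1 = y₁ c := by rw [hYc]
      rw [hYc1, hzρ] at h
      have h1 : B ^ N / 2 * (ρ / 2) = θ / 4 := by rw [← hρB]; ring
      rw [h1] at h
      have h2 : θ / 2 ≤ ‖A₁ * y₂ c ^ N * (z - c)‖ := by
        rw [norm_mul, norm_mul, norm_pow, hzρ, ← hB]
        have : θ / 2 = 1 * B ^ N * (ρ / 2) := by rw [← hρB]; ring
        rw [this]
        gcongr
      have h3 : A₁ * y₂ c ^ N * (z - c) = (Y z).1 - y₁ c -
          ((Y z).1 - A₁ * y₂ c ^ N * z - (y₁ c - A₁ * y₂ c ^ N * c)) := by ring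
      rw [h3] at h2
      have h4 := norm_sub_le ((Y z).1 - y₁ c)
        ((Y z).1 - A₁ * y₂ c ^ N * z - (y₁ c - A₁ * y₂ c ^ N * c))
      have h5 := norm_sub_le (Y z).1 (y₁ c)
      linarith
    · obtain ⟨-, -, h3⟩ := hbox _ (hYb z hzb)
      have h4 := norm_le_norm_add_norm_sub (Y z).2 (y₂ c)
      linarith
end

section
/- Consider the system obtained from the normalised Hamiltonian system in the variables u₁ = y₁·y₂^{−(N+1)/(M+1)}, u₂ = y₂ (for a fixed branch of y₂^{1/(M+1)}): u₁' = (N+1)u₂^{N−(N+1)/(M+1)}(1 + u₁^{M+1}) + Σ_{(i,j)∈I'} (j + i(N+1)/(M+1)) α_{ij} u₁^i u₂^{(i−1)(N+1)/(M+1)+j−1} and u₂' = −(M+1)u₁^M u₂^{M(N+1)/(M+1)} − Σ_{(i,j)∈I'} i α_{ij} u₁^{i−1} u₂^{(i−1)(N+1)/(M+1)+j}. Let K > 1 satisfy |i α_{ij}(z)| < K and |(j + i(N+1)/(M+1)) α_{ij}(z)| < K for all relevant (i,j) and z in the disc D = {|z−a| ≤ R₀}, and set C = 2^{N+1}K(M+1)(N+1),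 L = N − (N+1)/(M+1). Let 0 < Δ < 2^{−N−2}(N+1)^{−1} and θ = min{Δ/C, R₀}. If (u₁, u₂) is a solution analytic at a point c with |c − a| ≤ R₀/2, |u₁(c)| < θ/8 and |u₂(c)| > (4C)^{M+1}, then (u₁, u₂) is analytic on the disc |z − c| < θ/|u₂(c)|^L, and on the circle |z − c| = θ/(2|u₂(c)|^L) one has |u₁(z)| ≥ θ/8 and |u₂(z)| ≥ 1. -/
open scoped Topology
open Metric

/-- The index set `I = {(i,j) ∈ ℕ² : i(N+1) + j(M+1) < (N+1)(M+1)}`. -/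
def idxI (M N : ℕ) : Finset (ℕ × ℕ) :=
  (Finset.range (M + 2) ×ˢ Finset.range (N + 2)).filter
    fun p => p.1 * (N + 1) + p.2 * (M + 1) < (N + 1) * (M + 1)

/-- The index set `I' = I \ {(0,N)}`. -/
def idxI' (M N : ℕ) : Finset (ℕ × ℕ) := (idxI M N).erase (0, N)

theorem pic_step {E : Type*} [NormedAddCommGroup E] [NormedSpace ℂ E]
    (F : ℂ → E → E) (c : ℂ) (r : ℝ) (w0 : E) (δ B : ℝ) (hδ : 0 < δ)
    (hF : DifferentiableOn ℂ (fun p : ℂ × E => F p.1 p.2) (ball c r ×ˢ ball w0 δ))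
    (hB : ∀ z ∈ ball c r, ∀ w ∈ ball w0 δ, ‖F z w‖ ≤ B) (h : r * B ≤ δ / 8)
    (φ ψ f g : ℂ → E) (ε : ℝ) (hr : 0 < r)
    (hφ : ∀ z ∈ ball c r, φ z ∈ ball w0 (δ / 2)) (hψ : ∀ z ∈ ball c r, ψ z ∈ ball w0 (δ / 2))
    (hf : ∀ z ∈ ball c r, HasDerivAt f (F z (φ z)) z)
    (hg : ∀ z ∈ ball c r, HasDerivAt g (F z (ψ z)) z) (hfg : f c = g c)
    (hε : ∀ z ∈ ball c r, ‖φ z - ψ z‖ ≤ ε) : ∀ z ∈ ball c r, ‖f z - g z‖ ≤ ε / 2 := by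
  have hB0 : 0 ≤ B := (norm_nonneg _).trans (hB c (mem_ball_self hr) w0 (mem_ball_self hδ))
  have hε0 : 0 ≤ ε := (norm_nonneg _).trans (hε c (mem_ball_self hr))
  have lip : ∀ z ∈ ball c r, ‖F z (φ z) - F z (ψ z)‖ ≤ 2 * B / (δ) * 2 * ε := by
    intro z hz
    have h1 := hφ z hz
    have h2 := hψ z hz
    have hsub : ball (ψ z) (δ / 2) ⊆ ball w0 δ := by
      apply ball_subset_ball'
      rw [mem_ball] at h2
      linarith
    have hcur : DifferentiableOn ℂ (F z) (ball w0 δ) := by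
      have : DifferentiableOn ℂ ((fun p : ℂ × E => F p.1 p.2) ∘ (fun w => (z, w))) (ball w0 δ) := by
        apply hF.comp
        · fun_prop
        · intro w hw
          exact ⟨hz, hw⟩
      exact this
    have hps : ψ z ∈ ball w0 δ := hsub (mem_ball_self (by linarith))
    have hph : φ z ∈ ball w0 δ := ball_subset_ball (by linarith) h1
    by_cases hc : φ z ∈ ball (ψ z) (δ / 2)
    · have := Complex.dist_le_div_mul_dist_of_mapsTo_ball (f := F z) (c := ψ z) (z := φ z)
        (R₁ := δ / 2) (R₂ := 2 * B) (hcur.mono hsub) (by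
          intro w hw
          rw [mem_closedBall, dist_eq_norm]
          have := norm_sub_le (F z w) (F z (ψ z))
          have := hB z hz w (hsub hw)
          have := hB z hz _ hps
          linarith) hc
      rw [dist_eq_norm, dist_eq_norm] at this
      refine this.trans ?_
      have e : 2 * B / (δ / 2) = 2 * B / δ * 2 := by field_simp
      rw [e]
      gcongr
      exact hε z hz
    · have h3 := norm_sub_le (F z (φ z)) (F z (ψ z))
      have h4 := hB z hz _ hph
      have h5 := hB z hz _ hps
      have h6 : δ / 2 ≤ ε := by
        rw [mem_ball, not_lt, dist_eq_norm] at hc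
        exact hc.trans (hε z hz)
      have : 2 * B / δ * 2 * (δ / 2) ≤ 2 * B / δ * 2 * ε := by gcongr
      have e : 2 * B / δ * 2 * (δ / 2) = 2 * B := by field_simp
      linarith
  intro z hz
  have := (convex_ball c r).norm_image_sub_le_of_norm_hasDerivWithin_le (f := fun z => f z - g z)
    (f' := fun z => F z (φ z) - F z (ψ z)) (C := 2 * B / δ * 2 * ε) (x := c) (y := z)
    (fun x hx => ((hf x hx).sub (hg x hx)).hasDerivWithinAt) lip (mem_ball_self hr) hz
  simp only [hfg, sub_self, sub_zero] at this
  refine this.trans ?_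
  have hz' : ‖z - c‖ ≤ r := by
    rw [mem_ball, dist_eq_norm] at hz; exact hz.le
  calc 2 * B / δ * 2 * ε * ‖z - c‖ ≤ 2 * B / δ * 2 * ε * r := by gcongr
    _ = (r * B) * (4 * ε / δ) := by ring
    _ ≤ δ / 8 * (4 * ε / δ) := by gcongr
    _ = ε / 2 := by field_simp; ring

theorem pic_near {E : Type*} [NormedAddCommGroup E] [NormedSpace ℂ E]
    (c : ℂ) (r : ℝ) (w0 : E) (δ B : ℝ) (h : r * B ≤ δ / 8) (hr : 0 < r)
    (f f' : ℂ → E) (hB0 : 0 ≤ B)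
    (hf : ∀ z ∈ ball c r, HasDerivAt f (f' z) z) (hB : ∀ z ∈ ball c r, ‖f' z‖ ≤ B)
    (hfc : f c = w0) : ∀ z ∈ ball c r, ‖f z - w0‖ ≤ δ / 8 := by
  intro z hz
  have := (convex_ball c r).norm_image_sub_le_of_norm_hasDerivWithin_le (f := f)
    (f' := f') (C := B) (x := c) (y := z)
    (fun x hx => (hf x hx).hasDerivWithinAt) hB (mem_ball_self hr) hz
  have hz' : ‖z - c‖ ≤ r := by
    rw [mem_ball, dist_eq_norm] at hz; exact hz.le
  rw [hfc] at this
  have h2 : B * ‖z - c‖ ≤ B * r := by gcongr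
  linarith

theorem pic_uniq {E : Type*} [NormedAddCommGroup E] [NormedSpace ℂ E]
    (F : ℂ → E → E) (c : ℂ) (r : ℝ) (w0 : E) (δ B : ℝ) (hδ : 0 < δ)
    (hF : DifferentiableOn ℂ (fun p : ℂ × E => F p.1 p.2) (ball c r ×ˢ ball w0 δ))
    (hB : ∀ z ∈ ball c r, ∀ w ∈ ball w0 δ, ‖F z w‖ ≤ B) (h : r * B ≤ δ / 8)
    (f g : ℂ → E) (hr : 0 < r)
    (hf0 : ∀ z ∈ ball c r, f z ∈ ball w0 (δ / 2)) (hg0 : ∀ z ∈ ball c r, g z ∈ ball w0 (δ / 2))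
    (hf : ∀ z ∈ ball c r, HasDerivAt f (F z (f z)) z)
    (hg : ∀ z ∈ ball c r, HasDerivAt g (F z (g z)) z) (hfg : f c = g c) :
    ∀ z ∈ ball c r, f z = g z := by
  have key : ∀ n : ℕ, ∀ z ∈ ball c r, ‖f z - g z‖ ≤ δ * (1 / 2) ^ n := by
    intro n
    induction n with
    | zero =>
      intro z hz
      have h1 := hf0 z hz
      have h2 := hg0 z hz
      rw [mem_ball] at h1 h2
      have := dist_triangle_right (f z) (g z) w0
      rw [← dist_eq_norm]
      linarith
    | succ n ih =>
      intro z hz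
      have := pic_step F c r w0 δ B hδ hF hB h f g f g _ hr hf0 hg0 hf hg hfg ih z hz
      rw [pow_succ]
      linarith
  intro z hz
  have lim : Filter.Tendsto (fun n : ℕ => δ * (1 / 2 : ℝ) ^ n) Filter.atTop (𝓝 (δ * 0)) :=
    (tendsto_pow_atTop_nhds_zero_of_lt_one (by norm_num) (by norm_num)).const_mul δ
  have := ge_of_tendsto' lim (fun n => key n z hz)
  rw [mul_zero, norm_le_zero_iff, sub_eq_zero] at this
  exact this

theorem pic_exists {E : Type*} [NormedAddCommGroup E] [NormedSpace ℂ E] [CompleteSpace E]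
    (F : ℂ → E → E) (c : ℂ) (r : ℝ) (w0 : E) (δ B : ℝ) (hδ : 0 < δ)
    (hF : DifferentiableOn ℂ (fun p : ℂ × E => F p.1 p.2) (ball c r ×ˢ ball w0 δ))
    (hB : ∀ z ∈ ball c r, ∀ w ∈ ball w0 δ, ‖F z w‖ ≤ B) (h : r * B ≤ δ / 8) (hr : 0 < r) :
    ∃ f : ℂ → E, f c = w0 ∧ (∀ z ∈ ball c r, ‖f z - w0‖ ≤ δ / 8) ∧
      ∀ z ∈ ball c r, HasDerivAt f (F z (f z)) z := by
  have hB0 : 0 ≤ B := (norm_nonneg _).trans (hB c (mem_ball_self hr) w0 (mem_ball_self hδ))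
  have inball : ∀ w : E, ‖w - w0‖ ≤ δ / 8 → w ∈ ball w0 (δ / 2) := by
    intro w hw
    rw [mem_ball, dist_eq_norm]; linarith
  have hsub : ball w0 (δ / 2) ⊆ ball w0 δ := ball_subset_ball (by linarith)
  have prim : ∀ φ : ℂ → E, ∃ g : ℂ → E, (DifferentiableOn ℂ φ (ball c r) →
      (∀ z ∈ ball c r, ‖φ z - w0‖ ≤ δ / 8) →
      g c = w0 ∧ (∀ z ∈ ball c r, HasDerivAt g (F z (φ z)) z) ∧
        ∀ z ∈ ball c r, ‖g z - w0‖ ≤ δ / 8) := by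
    intro φ
    by_cases hd : DifferentiableOn ℂ φ (ball c r) ∧ (∀ z ∈ ball c r, ‖φ z - w0‖ ≤ δ / 8)
    · have hd2 : DifferentiableOn ℂ (fun z => F z (φ z)) (ball c r) := by
        have : DifferentiableOn ℂ ((fun p : ℂ × E => F p.1 p.2) ∘ (fun z => (z, φ z))) (ball c r) := by
          apply hF.comp
          · exact differentiableOn_id.prodMk hd.1
          · intro z hz
            exact ⟨hz, hsub (inball _ (hd.2 z hz))⟩
        exact this
      obtain ⟨g, hg1, hg2⟩ := hd2.isExactOn_ball.with_val_at c w0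
      refine ⟨g, fun _ _ => ⟨hg1, hg2, ?_⟩⟩
      exact pic_near c r w0 δ B h hr g _ hB0 hg2
        (fun z hz => hB z hz _ (hsub (inball _ (hd.2 z hz)))) hg1
    · exact ⟨fun _ => w0, fun h1 h2 => absurd ⟨h1, h2⟩ hd⟩
  choose P hP using prim
  let f : ℕ → ℂ → E := fun n => P^[n] (fun _ => w0)
  have fs : ∀ n, f (n + 1) = P (f n) := fun n => Function.iterate_succ_apply' P n _
  have inv : ∀ n, DifferentiableOn ℂ (f n) (ball c r) ∧ (∀ z ∈ ball c r, ‖f n z - w0‖ ≤ δ / 8) ∧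
      f n c = w0 := by
    intro n
    induction n with
    | zero =>
      refine ⟨differentiableOn_const _, fun z hz => ?_, rfl⟩
      simp [f]; positivity
    | succ n ih =>
      rw [fs]
      obtain ⟨h1, h2, h3⟩ := hP (f n) ih.1 ih.2.1
      exact ⟨fun z hz => (h2 z hz).differentiableAt.differentiableWithinAt, h3, h1⟩
  have hder : ∀ n, ∀ z ∈ ball c r, HasDerivAt (f (n + 1)) (F z (f n z)) z := by
    intro n
    rw [fs]
    exact (hP (f n) (inv n).1 (inv n).2.1).2.1
  have diff : ∀ n, ∀ z ∈ ball c r, ‖f n z - f (n + 1) z‖ ≤ δ * (1 / 2) ^ n := by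
    intro n
    induction n with
    | zero =>
      intro z hz
      have h1 := inball _ ((inv 0).2.1 z hz)
      have h2 := inball _ ((inv 1).2.1 z hz)
      rw [mem_ball] at h1 h2
      have := dist_triangle_right (f 0 z) (f 1 z) w0
      rw [← dist_eq_norm]
      simp only [zero_add, pow_zero]
      linarith
    | succ n ih =>
      intro z hz
      have := pic_step F c r w0 δ B hδ hF hB h (f n) (f (n + 1)) (f (n + 1)) (f (n + 2)) _ hr
        (fun z hz => inball _ ((inv _).2.1 z hz)) (fun z hz => inball _ ((inv _).2.1 z hz))
        (hder n) (hder (n + 1)) ((inv _).2.2.trans (inv _).2.2.symm) ih z hz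
      rw [pow_succ]
      linarith
  have hcau : ∀ z ∈ ball c r, ∃ l, Filter.Tendsto (fun n => f n z) Filter.atTop (𝓝 l) := by
    intro z hz
    apply cauchySeq_tendsto_of_complete
    exact cauchySeq_of_le_geometric (1 / 2) δ (by norm_num) (fun n => by
      rw [dist_eq_norm]; exact diff n z hz)
  choose! g hg using hcau
  have hgn : ∀ n, ∀ z ∈ ball c r, ‖f n z - g z‖ ≤ δ * (1 / 2) ^ n / (1 - 1 / 2) := by
    intro n z hz
    rw [← dist_eq_norm]
    exact dist_le_of_le_geometric_of_tendsto (1 / 2) δ (by norm_num) (fun n => by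
      rw [dist_eq_norm]; exact diff n z hz) (hg z hz) n
  have lim : Filter.Tendsto (fun n : ℕ => δ * (1 / 2 : ℝ) ^ n / (1 - 1 / 2)) Filter.atTop (𝓝 0) := by
    have := ((tendsto_pow_atTop_nhds_zero_of_lt_one (r := (1 / 2 : ℝ))
      (by norm_num) (by norm_num)).const_mul δ).div_const (1 - 1 / 2)
    simpa using this
  have hgd : DifferentiableOn ℂ g (ball c r) := by
    have hu : TendstoUniformlyOn f g Filter.atTop (ball c r) := by
      rw [Metric.tendstoUniformlyOn_iff]
      intro ε hε
      filter_upwards [lim.eventually (gt_mem_nhds hε)] with n hn z hz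
      rw [dist_comm, dist_eq_norm]
      exact (hgn n z hz).trans_lt hn
    exact hu.tendstoLocallyUniformlyOn.differentiableOn
      (Filter.Eventually.of_forall fun n => (inv n).1) isOpen_ball
  have hgb : ∀ z ∈ ball c r, ‖g z - w0‖ ≤ δ / 8 := by
    intro z hz
    exact le_of_tendsto' ((hg z hz).sub_const w0).norm (fun n => (inv n).2.1 z hz)
  obtain ⟨h1, h2, h3⟩ := hP g hgd hgb
  have heq : ∀ z ∈ ball c r, g z = P g z := by
    intro z hz
    have hk : ∀ n, ‖f (n + 1) z - P g z‖ ≤ δ * (1 / 2) ^ n / (1 - 1 / 2) / 2 := fun n =>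
      pic_step F c r w0 δ B hδ hF hB h (f n) g (f (n + 1)) (P g) _ hr
        (fun z hz => inball _ ((inv _).2.1 z hz)) (fun z hz => inball _ (hgb z hz))
        (hder n) h2 ((inv _).2.2.trans h1.symm) (hgn n) z hz
    have l1 : Filter.Tendsto (fun n => ‖f (n + 1) z - P g z‖) Filter.atTop (𝓝 ‖g z - P g z‖) :=
      (((hg z hz).comp (Filter.tendsto_add_atTop_nat 1)).sub_const _).norm
    have := le_of_tendsto_of_tendsto' l1 (lim.div_const 2) hk
    rw [zero_div, norm_le_zero_iff, sub_eq_zero] at this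
    exact this
  refine ⟨P g, h1, h3, fun z hz => ?_⟩
  have := h2 z hz
  rwa [heq z hz] at this

theorem est_pow (q : ℕ) (s : ℂ) (hq : 1 ≤ q) (hs : ‖s - 1‖ < 1 / (4 * (q : ℝ))) :
    s ≠ 0 ∧ (∀ e : ℤ, |e| ≤ (q : ℤ) → ‖s‖ ^ e ≤ 4 / 3) ∧ ∀ k : ℕ, k ≤ q → ‖s ^ k - 1‖ ≤ 1 / 3 := by
  have hq' : (1 : ℝ) ≤ q := by exact_mod_cast hq
  set δ : ℝ := 1 / (4 * (q : ℝ)) with hδ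
  have hδ0 : 0 < δ := by positivity
  have hqδ : q * δ = 1 / 4 := by rw [hδ]; field_simp
  have hδ1 : δ ≤ 1 / 4 := by nlinarith
  have h1 : ‖s‖ ≤ 1 + δ := by
    have := norm_add_le (s - 1) 1
    simp at this; linarith
  have h2 : 1 - δ ≤ ‖s‖ := by
    have := norm_sub_norm_le 1 (1 - s)
    rw [norm_sub_rev 1 s] at this
    simp at this; linarith
  have hs0 : 0 < ‖s‖ := by linarith
  have hb : 3 / 4 ≤ (1 - δ) ^ q := by
    have := one_add_mul_le_pow (a := -δ) (by linarith) q
    have e : (1 + -δ) = 1 - δ := by ring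
    rw [e] at this
    linarith
  have hinv : 1 + δ ≤ (1 - δ)⁻¹ := by
    rw [le_inv_comm₀ (by linarith) (by linarith), inv_eq_one_div, le_div_iff₀ (by linarith)]
    nlinarith
  have hg : (1 : ℝ) ≤ (1 - δ)⁻¹ := by linarith
  have hgq : ((1 - δ)⁻¹) ^ q ≤ 4 / 3 := by
    rw [inv_pow, inv_le_comm₀ (by linarith) (by norm_num)]
    norm_num; linarith
  have hpow : ∀ k : ℕ, k ≤ q → ((1 - δ)⁻¹) ^ k ≤ 4 / 3 := fun k hk =>
    (pow_le_pow_right₀ hg hk).trans hgq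
  refine ⟨norm_pos_iff.1 hs0, ?_, ?_⟩
  · intro e he
    obtain ⟨k, rfl | rfl⟩ := e.eq_nat_or_neg
    · rw [zpow_natCast]
      have hk : k ≤ q := by simpa using he
      refine le_trans ?_ (hpow k hk)
      gcongr
      linarith
    · have hk : k ≤ q := by simpa using he
      rw [zpow_neg, zpow_natCast, ← inv_pow]
      refine le_trans ?_ (hpow k hk)
      gcongr
      linarith
  · have aux : ∀ k : ℕ, ‖s ^ k - 1‖ ≤ (1 + δ) ^ k - 1 := by
      intro k
      induction k with
      | zero => simp
      | succ k ih =>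
        have e : s ^ (k + 1) - 1 = s * (s ^ k - 1) + (s - 1) := by ring
        rw [e]
        refine (norm_add_le _ _).trans ?_
        rw [norm_mul]
        have : ‖s‖ * ‖s ^ k - 1‖ ≤ (1 + δ) * ((1 + δ) ^ k - 1) := by gcongr
        rw [pow_succ]
        linarith
    intro k hk
    have := hpow k hk
    have h3 : (1 + δ) ^ k ≤ ((1 - δ)⁻¹) ^ k := by gcongr
    linarith [aux k]

theorem mem_idx {M N : ℕ} {p : ℕ × ℕ} (hp : p ∈ idxI' M N) :
    p.1 * (N + 1) + p.2 * (M + 1) < (N + 1) * (M + 1) := by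
  unfold idxI' idxI at hp
  simp only [Finset.mem_erase, Finset.mem_filter] at hp
  exact hp.2.2

theorem card_idx (M N : ℕ) : (idxI' M N).card ≤ (M + 1) * (N + 1) := by
  have : idxI' M N ⊆ Finset.range (M + 1) ×ˢ Finset.range (N + 1) := by
    intro p hp
    have := mem_idx hp
    rw [Finset.mem_product, Finset.mem_range, Finset.mem_range]
    constructor
    · by_contra hh
      push Not at hh
      nlinarith [Nat.mul_le_mul_right (N + 1) hh]
    · by_contra hh
      push Not at hh
      nlinarith [Nat.mul_le_mul_right (M + 1) hh]
  simpa using Finset.card_le_card this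

theorem est_sum (M N : ℕ) (K C : ℝ) (hK : 1 < K) (hN : 2 ≤ N)
    (hC : C = 2 ^ (N + 1) * K * (M + 1) * (N + 1)) (s0 s x : ℂ) (hs0 : 4 * C < ‖s0‖)
    (hs : ∀ e : ℤ, |e| ≤ (((M + 1) * (N + 1) : ℕ) : ℤ) → ‖s‖ ^ e ≤ 4 / 3) (hx : ‖x‖ ≤ 1)
    (b : ℕ × ℕ → ℂ) (m : ℕ × ℕ → ℕ) (e : ℕ × ℕ → ℤ) (k : ℕ)
    (hb : ∀ p ∈ idxI' M N, ‖b p‖ ≤ K)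
    (he : ∀ p ∈ idxI' M N, |e p| ≤ (((M + 1) * (N + 1) : ℕ) : ℤ))
    (hek : ∀ p ∈ idxI' M N, e p ≤ k - 1) :
    ‖∑ p ∈ idxI' M N, b p * x ^ m p * (s0 * s) ^ e p‖ ≤ ‖s0‖ ^ k / 24 := by
  set ρ := ‖s0‖
  have h8 : (8 : ℝ) ≤ 2 ^ (N + 1) := by
    calc (8 : ℝ) = 2 ^ 3 := by norm_num
      _ ≤ _ := pow_le_pow_right₀ (by norm_num) (by omega)
  have hq0 : (0 : ℝ) < (M + 1) * (N + 1) := by positivity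
  have hK0 : 0 < K := by linarith
  have hC8 : 8 * (K * ((M + 1) * (N + 1))) ≤ C := by
    rw [hC]
    have : 0 < K * ((M + 1) * (N + 1)) := by positivity
    nlinarith
  have hq1 : (1 : ℝ) ≤ (M + 1) * (N + 1) := by
    have h1 : (0 : ℝ) ≤ M := by positivity
    have h2 : (0 : ℝ) ≤ N := by positivity
    nlinarith [mul_nonneg h1 h2]
  have hC1 : 1 ≤ C := by nlinarith
  have hρ1 : 1 ≤ ρ := by linarith
  have hρ0 : 0 < ρ := by linarith
  have hterm : ∀ p ∈ idxI' M N, ‖b p * x ^ m p * (s0 * s) ^ e p‖ ≤ K * (4 / 3) * (ρ ^ k / ρ) := by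
    intro p hp
    rw [norm_mul, norm_mul, norm_pow, norm_zpow, norm_mul, mul_zpow]
    have h1 : ‖x‖ ^ m p ≤ 1 := pow_le_one₀ (norm_nonneg _) hx
    have h2 : ρ ^ e p ≤ ρ ^ k / ρ := by
      have : ρ ^ k / ρ = ρ ^ ((k : ℤ) - 1) := by
        rw [zpow_sub₀ hρ0.ne']; simp
      rw [this]
      exact zpow_le_zpow_right₀ hρ1 (hek p hp)
    have h3 := hs (e p) (he p hp)
    have h4 := hb p hp
    calc ‖b p‖ * ‖x‖ ^ m p * (ρ ^ e p * ‖s‖ ^ e p) ≤ K * 1 * ((ρ ^ k / ρ) * (4 / 3)) := by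
          gcongr
      _ = _ := by ring
  refine (norm_sum_le_of_le _ hterm).trans ?_
  rw [Finset.sum_const, nsmul_eq_mul]
  have hcard : ((idxI' M N).card : ℝ) ≤ (M + 1) * (N + 1) := by exact_mod_cast card_idx M N
  calc ((idxI' M N).card : ℝ) * (K * (4 / 3) * (ρ ^ k / ρ))
      ≤ ((M + 1) * (N + 1)) * (K * (4 / 3) * (ρ ^ k / ρ)) := by gcongr
    _ = (K * ((M + 1) * (N + 1))) * (4 / 3 * ρ ^ k) / ρ := by ring
    _ ≤ (ρ / 32) * (4 / 3 * ρ ^ k) / ρ := by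
        have : K * ((M + 1) * (N + 1)) ≤ ρ / 32 := by linarith
        gcongr
    _ = _ := by field_simp; norm_num

theorem exp_bounds {M N : ℕ} (hM : 2 ≤ M) (hN : 2 ≤ N) {p : ℕ × ℕ} (hp : p ∈ idxI' M N) :
    |((p.1 : ℤ) - 1) * ((N : ℤ) + 1) + ((p.2 : ℤ) - 1) * ((M : ℤ) + 1)| ≤ (((M + 1) * (N + 1) : ℕ) : ℤ) ∧
    |((p.1 : ℤ) - 1) * ((N : ℤ) + 1) + (p.2 : ℤ) * ((M : ℤ) + 1)| ≤ (((M + 1) * (N + 1) : ℕ) : ℤ) ∧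
    ((p.1 : ℤ) - 1) * ((N : ℤ) + 1) + ((p.2 : ℤ) - 1) * ((M : ℤ) + 1) ≤ ((M * N - 1 : ℕ) : ℤ) - 1 ∧
    ((p.1 : ℤ) - 1) * ((N : ℤ) + 1) + (p.2 : ℤ) * ((M : ℤ) + 1) ≤ ((M * (N + 1) : ℕ) : ℤ) - 1 := by
  have h := mem_idx hp
  obtain ⟨i, j⟩ := p
  simp only at h ⊢
  have hMN : 4 ≤ M * N := by nlinarith
  have h' : (i : ℤ) * (N + 1) + j * (M + 1) < (N + 1) * (M + 1) := by exact_mod_cast h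
  have h0 : (0 : ℤ) ≤ (i : ℤ) * (N + 1) := by positivity
  have h1 : (0 : ℤ) ≤ (j : ℤ) * (M + 1) := by positivity
  have hMN' : (4 : ℤ) ≤ M * N := by exact_mod_cast hMN
  have hM' : (2 : ℤ) ≤ M := by exact_mod_cast hM
  have hN' : (2 : ℤ) ≤ N := by exact_mod_cast hN
  have e3 : ((M * N - 1 : ℕ) : ℤ) = M * N - 1 := by
    rw [Nat.cast_sub (by omega)]; push_cast; ring
  rw [e3]
  push_cast
  refine ⟨abs_le.2 ⟨?_, ?_⟩, abs_le.2 ⟨?_, ?_⟩, ?_, ?_⟩ <;> nlinarith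

noncomputable def G1 (M N : ℕ) (α : ℕ × ℕ → ℂ → ℂ) (z x y : ℂ) : ℂ :=
  ((N : ℂ) + 1) * y ^ (M * N - 1) * (1 + x ^ (M + 1)) +
          ∑ p ∈ idxI' M N,
            ((p.2 : ℂ) + (p.1 : ℂ) * ((N : ℂ) + 1) / ((M : ℂ) + 1)) * α p z *
              x ^ p.1 * y ^ (((p.1 : ℤ) - 1) * ((N : ℤ) + 1) + ((p.2 : ℤ) - 1) * ((M : ℤ) + 1))

noncomputable def G2 (M N : ℕ) (α : ℕ × ℕ → ℂ → ℂ) (z x y : ℂ) : ℂ :=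
  -(((M : ℂ) + 1) * x ^ M * y ^ (M * (N + 1))) -
          ∑ p ∈ idxI' M N,
            (p.1 : ℂ) * α p z * x ^ (p.1 - 1) *
              y ^ (((p.1 : ℤ) - 1) * ((N : ℤ) + 1) + (p.2 : ℤ) * ((M : ℤ) + 1))

theorem norm_cast_add_one (n : ℕ) : ‖(n : ℂ) + 1‖ = (n : ℝ) + 1 := by
  have : (n : ℂ) + 1 = ((n + 1 : ℕ) : ℂ) := by push_cast; ring
  rw [this, Complex.norm_natCast]; push_cast; ring

theorem est_G1 (M N : ℕ) (hM : 2 ≤ M) (hN : 2 ≤ N) (K C : ℝ) (hK : 1 < K)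
    (hC : C = 2 ^ (N + 1) * K * (M + 1) * (N + 1)) (α : ℕ × ℕ → ℂ → ℂ)
    (z s0 s x : ℂ) (hs0 : 4 * C < ‖s0‖)
    (hs : ‖s - 1‖ < 1 / (4 * (((M + 1) * (N + 1) : ℕ) : ℝ))) (hx : ‖x‖ ≤ 1 / 4)
    (hb : ∀ p ∈ idxI' M N,
      ‖((p.2 : ℂ) + (p.1 : ℂ) * ((N : ℂ) + 1) / ((M : ℂ) + 1)) * α p z‖ < K) :
    ‖G1 M N α z x (s0 * s) - ((N : ℂ) + 1) * s0 ^ (M * N - 1)‖ ≤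
      ((N : ℝ) + 1) / 2 * ‖s0‖ ^ (M * N - 1) := by
  obtain ⟨-, hs1, hs2⟩ := est_pow _ s (Nat.succ_le_of_lt (by positivity)) hs
  have hsum := est_sum M N K C hK hN hC s0 s x hs0 hs1 (by linarith) _ (fun p => p.1) _ (M * N - 1)
    (fun p hp => (hb p hp).le) (fun p hp => (exp_bounds hM hN hp).1)
    (fun p hp => (exp_bounds hM hN hp).2.2.1)
  have hle : M * N - 1 ≤ (M + 1) * (N + 1) := by
    have : M * N ≤ (M + 1) * (N + 1) := Nat.mul_le_mul (by omega) (by omega)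
    omega
  have h1 := hs2 _ hle
  have h2 := hs1 ((M * N - 1 : ℕ) : ℤ) (by rw [abs_of_nonneg (by positivity)]; exact_mod_cast hle)
  rw [zpow_natCast] at h2
  have h3 : ‖x‖ ^ (M + 1) ≤ 1 / 64 := by
    calc ‖x‖ ^ (M + 1) ≤ (1 / 4) ^ (M + 1) := by gcongr
      _ ≤ (1 / 4) ^ 3 := pow_le_pow_of_le_one (by norm_num) (by norm_num) (by omega)
      _ = _ := by norm_num
  set k := M * N - 1
  have e : G1 M N α z x (s0 * s) - ((N : ℂ) + 1) * s0 ^ k =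
      (((N : ℂ) + 1) * s0 ^ k * (s ^ k - 1) + ((N : ℂ) + 1) * s0 ^ k * (s ^ k * x ^ (M + 1))) +
      ∑ p ∈ idxI' M N,
            ((p.2 : ℂ) + (p.1 : ℂ) * ((N : ℂ) + 1) / ((M : ℂ) + 1)) * α p z *
              x ^ p.1 * (s0 * s) ^ (((p.1 : ℤ) - 1) * ((N : ℤ) + 1) + ((p.2 : ℤ) - 1) * ((M : ℤ) + 1)) := by
    unfold G1
    rw [mul_pow]
    ring
  rw [e]
  refine (norm_add_le _ _).trans ?_
  refine (add_le_add (norm_add_le _ _) hsum).trans ?_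
  simp only [norm_mul, norm_pow, norm_cast_add_one]
  set P := ‖s0‖ ^ k
  have hP : 0 ≤ P := by positivity
  have hn : (2 : ℝ) ≤ N := by exact_mod_cast hN
  calc ((N : ℝ) + 1) * P * ‖s ^ k - 1‖ + (N + 1) * P * (‖s‖ ^ k * ‖x‖ ^ (M + 1)) + P / 24
      ≤ ((N : ℝ) + 1) * P * (1 / 3) + (N + 1) * P * (4 / 3 * (1 / 64)) + P / 24 := by gcongr
    _ ≤ _ := by nlinarith

theorem est_G2 (M N : ℕ) (hM : 2 ≤ M) (hN : 2 ≤ N) (K C : ℝ) (hK : 1 < K)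
    (hC : C = 2 ^ (N + 1) * K * (M + 1) * (N + 1)) (α : ℕ × ℕ → ℂ → ℂ)
    (z s0 s x : ℂ) (hs0 : 4 * C < ‖s0‖) (hs00 : 0 < ‖s0‖)
    (hs : ‖s - 1‖ < 1 / (4 * (((M + 1) * (N + 1) : ℕ) : ℝ))) (hx : ‖x‖ ≤ 1 / 4)
    (hb : ∀ p ∈ idxI' M N, ‖(p.1 : ℂ) * α p z‖ < K) :
    ‖G2 M N α z x (s0 * s) / (((M : ℂ) + 1) * (s0 * s) ^ M * s0)‖ ≤ ‖s0‖ ^ (M * N - 1) := by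
  obtain ⟨hsn, hs1, hs2⟩ := est_pow _ s (Nat.succ_le_of_lt (by positivity)) hs
  have hsum := est_sum M N K C hK hN hC s0 s x hs0 hs1 (by linarith) _ (fun p => p.1 - 1) _ (M * (N + 1))
    (fun p hp => (hb p hp).le) (fun p hp => (exp_bounds hM hN hp).2.1)
    (fun p hp => (exp_bounds hM hN hp).2.2.2)
  have hle : M * (N + 1) ≤ (M + 1) * (N + 1) := Nat.mul_le_mul (by omega) (by omega)
  have h2 := hs1 ((M * (N + 1) : ℕ) : ℤ) (by rw [abs_of_nonneg (by positivity)]; exact_mod_cast hle)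
  rw [zpow_natCast] at h2
  have hsp : 0 < ‖s‖ := norm_pos_iff.2 hsn
  have h4 : (‖s‖ ^ M)⁻¹ ≤ 4 / 3 := by
    have := hs1 (-(M : ℤ)) (by
      rw [abs_neg, abs_of_nonneg (by positivity)]
      have : M ≤ (M + 1) * (N + 1) := by nlinarith
      exact_mod_cast this)
    rwa [zpow_neg, zpow_natCast] at this
  have h3 : ‖x‖ ^ M ≤ 1 / 16 := by
    calc ‖x‖ ^ M ≤ (1 / 4) ^ M := by gcongr
      _ ≤ (1 / 4) ^ 2 := pow_le_pow_of_le_one (by norm_num) (by norm_num) (by omega)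
      _ = _ := by norm_num
  have hm : (2 : ℝ) ≤ M := by exact_mod_cast hM
  have hG : ‖G2 M N α z x (s0 * s)‖ ≤ ((M : ℝ) + 1) * ‖s0‖ ^ (M * (N + 1)) / 8 := by
    unfold G2
    refine (norm_sub_le _ _).trans ?_
    refine (add_le_add le_rfl hsum).trans ?_
    rw [norm_neg, norm_mul, norm_mul, norm_pow, norm_pow, norm_mul, mul_pow, norm_cast_add_one]
    set P := ‖s0‖ ^ (M * (N + 1))
    have hP : 0 ≤ P := by positivity
    calc ((M : ℝ) + 1) * ‖x‖ ^ M * (P * ‖s‖ ^ (M * (N + 1))) + P / 24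
        ≤ ((M : ℝ) + 1) * (1 / 16) * (P * (4 / 3)) + P / 24 := by gcongr
      _ ≤ _ := by nlinarith
  rw [norm_div, norm_mul, norm_mul, norm_pow, norm_mul, mul_pow, norm_cast_add_one]
  have hk : M * (N + 1) = (M * N - 1) + M + 1 := by
    have : 4 ≤ M * N := by nlinarith
    rw [Nat.mul_add]; omega
  rw [hk] at hG
  set k := M * N - 1
  set ρ := ‖s0‖
  calc ‖G2 M N α z x (s0 * s)‖ / (((M : ℝ) + 1) * (ρ ^ M * ‖s‖ ^ M) * ρ)
      ≤ (((M : ℝ) + 1) * ρ ^ (k + M + 1) / 8) / (((M : ℝ) + 1) * (ρ ^ M * ‖s‖ ^ M) * ρ) := by gcongr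
    _ = ρ ^ k / 8 * (‖s‖ ^ M)⁻¹ := by
        rw [pow_succ, pow_add]; field_simp
    _ ≤ ρ ^ k / 8 * (4 / 3) := by gcongr
    _ ≤ ρ ^ k := by
        have : 0 ≤ ρ ^ k := by positivity
        linarith


set_option maxHeartbeats 1600000 in
theorem core (M N : ℕ) (hM : 2 ≤ M) (hN : 2 ≤ N)
    (a : ℂ) (R₀ : ℝ) (α : ℕ × ℕ → ℂ → ℂ)
    (hα : ∀ p ∈ idxI' M N, AnalyticOnNhd ℂ (α p) (closedBall a R₀))
    (K C θ : ℝ) (hK : 1 < K) (hC : C = 2 ^ (N + 1) * K * (M + 1) * (N + 1))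
    (hKb : ∀ p ∈ idxI' M N, ∀ z ∈ closedBall a R₀,
        ‖(p.1 : ℂ) * α p z‖ < K ∧
        ‖((p.2 : ℂ) + (p.1 : ℂ) * ((N : ℂ) + 1) / ((M : ℂ) + 1)) * α p z‖ < K)
    (hθ0 : 0 < θ) (hθ1 : θ * (128 * ((N : ℝ) + 1) * (((M : ℝ) + 1) * (N + 1))) ≤ 1) (hθR : θ ≤ R₀)
    (c : ℂ) (hc : ‖c - a‖ ≤ R₀ / 2)
    (U : Set ℂ) (hU : IsOpen U) (hcU : c ∈ U)
    (u₁ u₂ σ : ℂ → ℂ)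
    (hu₁ : AnalyticOnNhd ℂ u₁ U) (hu₂ : AnalyticOnNhd ℂ u₂ U)
    (hσa : AnalyticOnNhd ℂ σ U)
    (hσ : ∀ z ∈ U, σ z ^ (M + 1) = u₂ z ∧ σ z ≠ 0)
    (hode : ∀ z ∈ U, deriv u₁ z = G1 M N α z (u₁ z) (σ z) ∧ deriv u₂ z = G2 M N α z (u₁ z) (σ z))
    (hu₁c : ‖u₁ c‖ < θ / 8) (hs0 : 4 * C < ‖σ c‖) :
    ∃ W₁ W₃ : ℂ → ℂ, (∀ z ∈ ball c (θ / ‖σ c‖ ^ (M * N - 1)),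
        DifferentiableAt ℂ W₃ z ∧ W₃ z ≠ 0 ∧ HasDerivAt W₁ (G1 M N α z (W₁ z) (W₃ z)) z ∧
        HasDerivAt (fun z => W₃ z ^ (M + 1)) (G2 M N α z (W₁ z) (W₃ z)) z ∧ 1 ≤ ‖W₃ z‖) ∧
      (∀ᶠ z in 𝓝 c, W₁ z = u₁ z ∧ W₃ z ^ (M + 1) = u₂ z ∧ W₃ z = σ z) ∧
      ∀ z : ℂ, ‖z - c‖ = θ / ‖σ c‖ ^ (M * N - 1) / 2 → θ / 8 ≤ ‖W₁ z‖ := by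
  set s0 := σ c with hs0def
  set ρ := ‖s0‖ with hρdef
  set k := M * N - 1 with hk
  have hMr : (2 : ℝ) ≤ M := by exact_mod_cast hM
  have hNr : (2 : ℝ) ≤ N := by exact_mod_cast hN
  have hq9 : (9 : ℝ) ≤ ((M : ℝ) + 1) * (N + 1) := by nlinarith
  have hC1 : 1 ≤ C := by
    rw [hC]
    have h2 : (1 : ℝ) ≤ 2 ^ (N + 1) := one_le_pow₀ (by norm_num)
    have h3 : (1 : ℝ) ≤ 2 ^ (N + 1) * K := by nlinarith
    have : (1 : ℝ) ≤ (2 ^ (N + 1) * K) * (((M : ℝ) + 1) * (N + 1)) := by nlinarith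
    linarith
  have hρ4 : 4 < ρ := by linarith
  have hρ0 : 0 < ρ := by linarith
  have hs0n : s0 ≠ 0 := norm_pos_iff.1 hρ0
  set q : ℝ := ((M : ℝ) + 1) * (N + 1) with hq
  have hqc : (((M + 1) * (N + 1) : ℕ) : ℝ) = q := by push_cast; rfl
  set δ : ℝ := 1 / (4 * (((M + 1) * (N + 1) : ℕ) : ℝ)) with hδ
  have hδ' : δ = 1 / (4 * q) := by rw [hδ, hqc]
  have hq0 : 0 < q := by linarith
  have hδ0 : 0 < δ := by rw [hδ']; positivity
  have hδq : δ * q = 1 / 4 := by rw [hδ']; field_simp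
  have hδs : δ ≤ 1 / 36 := by nlinarith
  have hP0 : 0 < ρ ^ k := by positivity
  have hk1 : 1 ≤ k := by
    have : 4 ≤ M * N := by nlinarith
    omega
  have hP4 : 4 < ρ ^ k := hρ4.trans_le (le_self_pow₀ (by linarith) (by omega))
  set r := θ / ρ ^ k with hr
  have hr0 : 0 < r := by positivity
  have hrP : r * ρ ^ k = θ := by rw [hr]; field_simp
  set B : ℝ := 3 / 2 * ((N : ℝ) + 1) * ρ ^ k with hB
  have hrB : r * B ≤ δ / 8 := by
    have e1 : r * B = 3 / 2 * ((N : ℝ) + 1) * θ := by rw [hB, ← hrP]; ring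
    rw [e1]
    have : (3 / 2 * ((N : ℝ) + 1) * θ) * q ≤ δ / 8 * q := by nlinarith
    exact le_of_mul_le_mul_right this hq0
  have hθs : θ ≤ 1 / 128 := by
    have : (1 : ℝ) ≤ (N + 1) * q := by nlinarith
    nlinarith
  have hball : ∀ z ∈ ball c r, z ∈ closedBall a R₀ := by
    intro z hz
    rw [mem_ball, dist_eq_norm] at hz
    rw [mem_closedBall, dist_eq_norm]
    have h1 := norm_add_le (z - c) (c - a)
    rw [sub_add_sub_cancel] at h1
    have h2 : r ≤ R₀ / 2 := by
      have : 4 * r ≤ θ := by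
        have := mul_lt_mul_of_pos_left hP4 hr0
        linarith
      linarith
    linarith
  let w0 : ℂ × ℂ := (u₁ c, 1)
  let F : ℂ → ℂ × ℂ → ℂ × ℂ := fun z w =>
    (G1 M N α z w.1 (s0 * w.2), G2 M N α z w.1 (s0 * w.2) / (((M : ℂ) + 1) * (s0 * w.2) ^ M * s0))
  have hw : ∀ w ∈ ball w0 δ, ‖w.1‖ ≤ 1 / 4 ∧ ‖w.2 - 1‖ < δ ∧ w.2 ≠ 0 := by
    intro w hw
    rw [mem_ball, Prod.dist_eq, max_lt_iff, dist_eq_norm, dist_eq_norm] at hw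
    have h1 : ‖w.1 - u₁ c‖ < δ := hw.1
    have h2 : ‖w.2 - 1‖ < δ := hw.2
    refine ⟨?_, h2, ?_⟩
    · have := norm_add_le (w.1 - u₁ c) (u₁ c)
      rw [sub_add_cancel] at this
      linarith
    · exact (est_pow ((M + 1) * (N + 1)) w.2 (Nat.succ_le_of_lt (by positivity)) h2).1
  have hM1 : (M : ℂ) + 1 ≠ 0 := by exact_mod_cast Nat.succ_ne_zero M
  have hE1 : ∀ z ∈ ball c r, ∀ w ∈ ball w0 δ,
      ‖(F z w).1 - ((N : ℂ) + 1) * s0 ^ k‖ ≤ ((N : ℝ) + 1) / 2 * ρ ^ k := by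
    intro z hz w hww
    obtain ⟨h1, h2, h3⟩ := hw w hww
    exact est_G1 M N hM hN K C hK hC α z s0 w.2 w.1 hs0 h2 h1
      (fun p hp => (hKb p hp z (hball z hz)).2)
  have hFB : ∀ z ∈ ball c r, ∀ w ∈ ball w0 δ, ‖F z w‖ ≤ B := by
    intro z hz w hww
    obtain ⟨h1, h2, h3⟩ := hw w hww
    rw [Prod.norm_def, max_le_iff]
    constructor
    · have h4 := hE1 z hz w hww
      have h5 := norm_add_le ((F z w).1 - ((N : ℂ) + 1) * s0 ^ k) (((N : ℂ) + 1) * s0 ^ k)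
      rw [sub_add_cancel, norm_mul, norm_pow, norm_cast_add_one] at h5
      rw [hB]
      linarith
    · have h4 := est_G2 M N hM hN K C hK hC α z s0 w.2 w.1 hs0 hρ0 h2 h1
        (fun p hp => (hKb p hp z (hball z hz)).1)
      refine h4.trans ?_
      rw [hB]
      nlinarith
  have hFd : DifferentiableOn ℂ (fun p : ℂ × (ℂ × ℂ) => F p.1 p.2) (ball c r ×ˢ ball w0 δ) := by
    rintro ⟨z, w⟩ ⟨hz, hww⟩
    apply DifferentiableAt.differentiableWithinAt
    obtain ⟨-, -, h3⟩ := hw w hww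
    have hne : s0 * w.2 ≠ 0 := mul_ne_zero hs0n h3
    have hx : DifferentiableAt ℂ (fun p : ℂ × (ℂ × ℂ) => p.2.1) (z, w) := by fun_prop
    have hy : DifferentiableAt ℂ (fun p : ℂ × (ℂ × ℂ) => s0 * p.2.2) (z, w) := by fun_prop
    have hyz : ∀ e : ℤ, DifferentiableAt ℂ (fun p : ℂ × (ℂ × ℂ) => (s0 * p.2.2) ^ e) (z, w) :=
      fun e => hy.zpow (Or.inl hne)
    have ha : ∀ p ∈ idxI' M N, DifferentiableAt ℂ (fun t : ℂ × (ℂ × ℂ) => α p t.1) (z, w) := by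
      intro p hp
      have h1 : DifferentiableAt ℂ (α p) z := (hα p hp z (hball z hz)).differentiableAt
      exact DifferentiableAt.comp (f := fun t : ℂ × (ℂ × ℂ) => t.1) (z, w) h1 differentiableAt_fst
    apply DifferentiableAt.prodMk
    · unfold G1
      apply DifferentiableAt.add
      · fun_prop
      · apply DifferentiableAt.fun_sum
        intro p hp
        exact (((ha p hp).const_mul _).mul (hx.pow _)).mul (hyz _)
    · simp only [div_eq_mul_inv]
      refine DifferentiableAt.mul ?_ (DifferentiableAt.fun_inv ?_ ?_)
      · unfold G2
        apply DifferentiableAt.sub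
        · fun_prop
        · apply DifferentiableAt.fun_sum
          intro p hp
          exact (((ha p hp).const_mul _).mul (hx.pow _)).mul (hyz _)
      · fun_prop
      · exact mul_ne_zero (mul_ne_zero hM1 (pow_ne_zero _ hne)) hs0n
  obtain ⟨f, hfc, hfn, hfd⟩ := pic_exists F c r w0 δ B hδ0 hFd hFB hrB hr0
  have hfb2 : ∀ z ∈ ball c r, f z ∈ ball w0 (δ / 2) := by
    intro z hz
    rw [mem_ball, dist_eq_norm]
    linarith [hfn z hz]
  have hfb : ∀ z ∈ ball c r, f z ∈ ball w0 δ := fun z hz =>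
    ball_subset_ball (by linarith) (hfb2 z hz)
  have hd1 : ∀ z ∈ ball c r, HasDerivAt (fun z => (f z).1) (F z (f z)).1 z := fun z hz =>
    (hasFDerivAt_fst (𝕜 := ℂ) (p := f z)).comp_hasDerivAt z (hfd z hz)
  have hd2 : ∀ z ∈ ball c r, HasDerivAt (fun z => (f z).2) (F z (f z)).2 z := fun z hz =>
    (hasFDerivAt_snd (𝕜 := ℂ) (p := f z)).comp_hasDerivAt z (hfd z hz)
  refine ⟨fun z => (f z).1, fun z => s0 * (f z).2, ?_, ?_, ?_⟩
  · intro z hz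
    obtain ⟨h1, h2, h3⟩ := hw _ (hfb z hz)
    have hne : s0 * (f z).2 ≠ 0 := mul_ne_zero hs0n h3
    have hd3 := (hd2 z hz).const_mul s0
    refine ⟨hd3.differentiableAt, hne, hd1 z hz, ?_, ?_⟩
    · refine (hd3.fun_pow (M + 1)).congr_deriv ?_
      show ((M + 1 : ℕ) : ℂ) * (s0 * (f z).2) ^ M * (s0 * (G2 M N α z (f z).1 (s0 * (f z).2) /
        (((M : ℂ) + 1) * (s0 * (f z).2) ^ M * s0))) = G2 M N α z (f z).1 (s0 * (f z).2)
      have hpn : (s0 * (f z).2) ^ M ≠ 0 := pow_ne_zero _ hne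
      generalize (s0 * (f z).2) ^ M = Y at *
      push_cast
      field_simp
    · show 1 ≤ ‖s0 * (f z).2‖
      rw [norm_mul]
      have := norm_sub_norm_le 1 (1 - (f z).2)
      rw [norm_sub_rev 1 (f z).2] at this
      simp at this
      have h5 : 1 / 2 ≤ ‖(f z).2‖ := by linarith
      nlinarith
  · let g : ℂ → ℂ × ℂ := fun z => (u₁ z, σ z / s0)
    have hgd : ∀ z ∈ U, HasDerivAt g (F z (g z)) z := by
      intro z hz
      have hσn := (hσ z hz).2
      have e : s0 * (σ z / s0) = σ z := by field_simp
      apply HasDerivAt.prodMk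
      · show HasDerivAt u₁ (G1 M N α z (u₁ z) (s0 * (σ z / s0))) z
        rw [e, ← (hode z hz).1]
        exact (hu₁ z hz).differentiableAt.hasDerivAt
      · show HasDerivAt (fun z => σ z / s0) (G2 M N α z (u₁ z) (s0 * (σ z / s0)) /
          (((M : ℂ) + 1) * (s0 * (σ z / s0)) ^ M * s0)) z
        rw [e, ← (hode z hz).2]
        have h1 := (hσa z hz).differentiableAt.hasDerivAt
        have h2 := h1.fun_pow (M + 1)
        have h3 : u₂ =ᶠ[𝓝 z] fun z => σ z ^ (M + 1) := by
          filter_upwards [hU.mem_nhds hz] with y hy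
          exact (hσ y hy).1.symm
        rw [h3.deriv_eq, h2.deriv]
        refine (h1.div_const s0).congr_deriv ?_
        rw [Nat.add_sub_cancel]
        push_cast
        field_simp
    have hgc : g c = w0 := by
      simp only [g, w0, ← hs0def, div_self hs0n]
    have hgcont : ContinuousAt g c := (hgd c hcU).continuousAt
    have hev : ∀ᶠ z in 𝓝 c, z ∈ U ∧ g z ∈ ball w0 (δ / 2) := by
      filter_upwards [hU.mem_nhds hcU, hgcont.preimage_mem_nhds
        (hgc ▸ ball_mem_nhds w0 (half_pos hδ0) : ball w0 (δ / 2) ∈ 𝓝 (g c))] with z h1 h2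
      exact ⟨h1, h2⟩
    obtain ⟨r1, hr1, hr1b⟩ := Metric.eventually_nhds_iff_ball.1 hev
    set r' := min r1 r with hr'
    have hr'0 : 0 < r' := lt_min hr1 hr0
    have hsub : ball c r' ⊆ ball c r := ball_subset_ball (min_le_right _ _)
    have hsub1 : ball c r' ⊆ ball c r1 := ball_subset_ball (min_le_left _ _)
    have hB0 : 0 ≤ B := by rw [hB]; positivity
    have huq := pic_uniq F c r' w0 δ B hδ0 (hFd.mono (Set.prod_mono hsub le_rfl))
      (fun z hz => hFB z (hsub hz)) ((mul_le_mul_of_nonneg_right (min_le_right _ _) hB0).trans hrB)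
      f g hr'0 (fun z hz => hfb2 z (hsub hz)) (fun z hz => (hr1b z (hsub1 hz)).2)
      (fun z hz => hfd z (hsub hz)) (fun z hz => hgd z (hr1b z (hsub1 hz)).1) (hfc.trans hgc.symm)
    filter_upwards [ball_mem_nhds c hr'0] with z hz
    have e : s0 * (σ z / s0) = σ z := by field_simp
    have h1 := huq z hz
    have h2 := (hσ z (hr1b z (hsub1 hz)).1).1
    simp only [h1, g, e, h2, and_self]
  · intro z hzc
    have hz : z ∈ ball c r := by
      rw [mem_ball, dist_eq_norm, hzc]; linarith
    have hD : ∀ x ∈ ball c r, HasDerivWithinAt (fun z => (f z).1 - ((N : ℂ) + 1) * s0 ^ k * z)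
        ((F x (f x)).1 - ((N : ℂ) + 1) * s0 ^ k) (ball c r) x := by
      intro x hx
      have := (hd1 x hx).sub ((hasDerivAt_id x).const_mul (((N : ℂ) + 1) * s0 ^ k))
      rw [mul_one] at this
      exact this.hasDerivWithinAt
    have := (convex_ball c r).norm_image_sub_le_of_norm_hasDerivWithin_le hD
      (fun x hx => hE1 x hx _ (hfb x hx)) (mem_ball_self hr0) hz
    rw [hzc, hfc] at this
    have e : ((N : ℂ) + 1) * s0 ^ k * (z - c) = (f z).1 - u₁ c -
      ((f z).1 - ((N : ℂ) + 1) * s0 ^ k * z - (w0.1 - ((N : ℂ) + 1) * s0 ^ k * c)) := by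
      simp only [w0]; ring
    have h6 := congrArg norm e
    rw [norm_mul, norm_mul, norm_pow, norm_cast_add_one, hzc] at h6
    have h7 := norm_sub_le ((f z).1 - u₁ c)
      ((f z).1 - ((N : ℂ) + 1) * s0 ^ k * z - (w0.1 - ((N : ℂ) + 1) * s0 ^ k * c))
    have h8 := norm_sub_le (f z).1 (u₁ c)
    rw [← h6] at h7
    have e2 : ((N : ℝ) + 1) * ρ ^ k * (r / 2) = ((N : ℝ) + 1) / 2 * θ := by rw [← hrP]; ring
    have e3 : ((N : ℝ) + 1) / 2 * ρ ^ k * (r / 2) = ((N : ℝ) + 1) / 4 * θ := by rw [← hrP]; ring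
    rw [e3] at this
    rw [← hρdef, e2] at h7
    show θ / 8 ≤ ‖(f z).1‖
    nlinarith


/-- Circle lemma for the transformed system in `u₁ = y₁·y₂^{-(N+1)/(M+1)}`,
`u₂ = y₂` (with `σ` a fixed analytic branch of `u₂^{1/(M+1)}`, so that rational
powers `u₂^{p/(M+1)}` are realised as integer powers `σ^p`):  with
`C = 2^(N+1)K(M+1)(N+1)`, `L = N − (N+1)/(M+1) = (MN−1)/(M+1)`,
`0 < Δ < 2^{−N−2}(N+1)^{−1}` and `θ = min (Δ/C) R₀`, if a solution is analytic at `c`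
with `|c−a| ≤ R₀/2`, `|u₁(c)| < θ/8` and `|u₂(c)| > (4C)^{M+1}`, then it extends
analytically to the disc `|z−c| < θ/|u₂(c)|^L` and satisfies `|u₁| ≥ θ/8`,
`|u₂| ≥ 1` on the circle `|z−c| = θ/(2|u₂(c)|^L)`. -/
theorem circle_lemma_transformed (M N : ℕ) (hM : 2 ≤ M) (hMN : M ≤ N)
    (a : ℂ) (R₀ : ℝ) (hR₀ : 0 < R₀)
    (α : ℕ × ℕ → ℂ → ℂ)
    (hα1 : ∀ z : ℂ, α (M + 1, 0) z = 1 ∧ α (0, N + 1) z = 1)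
    (hα : ∀ p ∈ idxI' M N, AnalyticOnNhd ℂ (α p) (closedBall a R₀))
    (K : ℝ) (hK : 1 < K)
    (hKb : ∀ p ∈ insert (M + 1, 0) (insert (0, N + 1) (idxI' M N)),
      ∀ z ∈ closedBall a R₀,
        ‖(p.1 : ℂ) * α p z‖ < K ∧
        ‖((p.2 : ℂ) + (p.1 : ℂ) * ((N : ℂ) + 1) / ((M : ℂ) + 1)) * α p z‖ < K)
    (Δ : ℝ) (hΔ0 : 0 < Δ) (hΔ1 : Δ < 1 / (2 ^ (N + 2) * ((N : ℝ) + 1)))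
    (c : ℂ) (hc : ‖c - a‖ ≤ R₀ / 2)
    (U : Set ℂ) (hU : IsOpen U) (hcU : c ∈ U)
    (u₁ u₂ σ : ℂ → ℂ)
    (hu₁ : AnalyticOnNhd ℂ u₁ U) (hu₂ : AnalyticOnNhd ℂ u₂ U)
    (hσa : AnalyticOnNhd ℂ σ U)
    (hσ : ∀ z ∈ U, σ z ^ (M + 1) = u₂ z ∧ σ z ≠ 0)
    (hode : ∀ z ∈ U,
      deriv u₁ z = ((N : ℂ) + 1) * σ z ^ (M * N - 1) * (1 + u₁ z ^ (M + 1)) +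
          ∑ p ∈ idxI' M N,
            ((p.2 : ℂ) + (p.1 : ℂ) * ((N : ℂ) + 1) / ((M : ℂ) + 1)) * α p z *
              u₁ z ^ p.1 * σ z ^ (((p.1 : ℤ) - 1) * ((N : ℤ) + 1) + ((p.2 : ℤ) - 1) * ((M : ℤ) + 1)) ∧
      deriv u₂ z = -(((M : ℂ) + 1) * u₁ z ^ M * σ z ^ (M * (N + 1))) -
          ∑ p ∈ idxI' M N,
            (p.1 : ℂ) * α p z * u₁ z ^ (p.1 - 1) *
              σ z ^ (((p.1 : ℤ) - 1) * ((N : ℤ) + 1) + (p.2 : ℤ) * ((M : ℤ) + 1)))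
    (hu₁c : ‖u₁ c‖ < min (Δ / (2 ^ (N + 1) * K * (M + 1) * (N + 1))) R₀ / 8)
    (hu₂c : ‖u₂ c‖ > (4 * (2 ^ (N + 1) * K * (M + 1) * (N + 1))) ^ (M + 1)) :
    ∃ W₁ W₂ W₃ : ℂ → ℂ,
      AnalyticOnNhd ℂ W₁ (ball c (min (Δ / (2 ^ (N + 1) * K * (M + 1) * (N + 1))) R₀ /
        ‖u₂ c‖ ^ (((M : ℝ) * N - 1) / ((M : ℝ) + 1)))) ∧
      AnalyticOnNhd ℂ W₂ (ball c (min (Δ / (2 ^ (N + 1) * K * (M + 1) * (N + 1))) R₀ /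
        ‖u₂ c‖ ^ (((M : ℝ) * N - 1) / ((M : ℝ) + 1)))) ∧
      AnalyticOnNhd ℂ W₃ (ball c (min (Δ / (2 ^ (N + 1) * K * (M + 1) * (N + 1))) R₀ /
        ‖u₂ c‖ ^ (((M : ℝ) * N - 1) / ((M : ℝ) + 1)))) ∧
      (∀ z ∈ ball c (min (Δ / (2 ^ (N + 1) * K * (M + 1) * (N + 1))) R₀ /
          ‖u₂ c‖ ^ (((M : ℝ) * N - 1) / ((M : ℝ) + 1))),
        W₃ z ^ (M + 1) = W₂ z ∧ W₃ z ≠ 0 ∧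
        deriv W₁ z = ((N : ℂ) + 1) * W₃ z ^ (M * N - 1) * (1 + W₁ z ^ (M + 1)) +
            ∑ p ∈ idxI' M N,
              ((p.2 : ℂ) + (p.1 : ℂ) * ((N : ℂ) + 1) / ((M : ℂ) + 1)) * α p z *
                W₁ z ^ p.1 * W₃ z ^ (((p.1 : ℤ) - 1) * ((N : ℤ) + 1) + ((p.2 : ℤ) - 1) * ((M : ℤ) + 1)) ∧
        deriv W₂ z = -(((M : ℂ) + 1) * W₁ z ^ M * W₃ z ^ (M * (N + 1))) -
            ∑ p ∈ idxI' M N,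
              (p.1 : ℂ) * α p z * W₁ z ^ (p.1 - 1) *
                W₃ z ^ (((p.1 : ℤ) - 1) * ((N : ℤ) + 1) + (p.2 : ℤ) * ((M : ℤ) + 1))) ∧
      (∀ᶠ z in 𝓝 c, W₁ z = u₁ z ∧ W₂ z = u₂ z ∧ W₃ z = σ z) ∧
      ∀ z : ℂ,
        ‖z - c‖ = min (Δ / (2 ^ (N + 1) * K * (M + 1) * (N + 1))) R₀ /
          (2 * ‖u₂ c‖ ^ (((M : ℝ) * N - 1) / ((M : ℝ) + 1))) →
        min (Δ / (2 ^ (N + 1) * K * (M + 1) * (N + 1))) R₀ / 8 ≤ ‖W₁ z‖ ∧ 1 ≤ ‖W₂ z‖ := by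
  set C : ℝ := 2 ^ (N + 1) * K * (M + 1) * (N + 1) with hC
  set θ : ℝ := min (Δ / C) R₀ with hθ
  have hN : 2 ≤ N := hM.trans hMN
  have hK0 : 0 < K := by linarith
  have hC0 : 0 < C := by rw [hC]; positivity
  have hθ0 : 0 < θ := lt_min (by positivity) hR₀
  have hσc := hσ c hcU
  have hnu : ‖u₂ c‖ = ‖σ c‖ ^ (M + 1) := by rw [← hσc.1, norm_pow]
  have hs0 : 4 * C < ‖σ c‖ := by
    rw [hnu] at hu₂c
    exact lt_of_pow_lt_pow_left₀ _ (norm_nonneg _) hu₂c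
  have hL : ‖u₂ c‖ ^ (((M : ℝ) * N - 1) / ((M : ℝ) + 1)) = ‖σ c‖ ^ (M * N - 1) := by
    have hMN1 : 1 ≤ M * N := by nlinarith
    rw [hnu, ← Real.rpow_natCast, ← Real.rpow_mul (norm_nonneg _), ← Real.rpow_natCast]
    congr 1
    rw [Nat.cast_sub hMN1]
    push_cast
    field_simp
  have hθ1 : θ * (128 * ((N : ℝ) + 1) * (((M : ℝ) + 1) * (N + 1))) ≤ 1 := by
    have h1 : θ * C ≤ Δ := by
      have : θ ≤ Δ / C := min_le_left _ _
      rwa [le_div_iff₀ hC0] at this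
    have h2 : Δ * (2 ^ (N + 2) * ((N : ℝ) + 1)) < 1 := by
      rwa [lt_div_iff₀ (by positivity)] at hΔ1
    have h3 : (8 : ℝ) ≤ 2 ^ (N + 1) := by
      calc (8 : ℝ) = 2 ^ 3 := by norm_num
        _ ≤ _ := pow_le_pow_right₀ (by norm_num) (by omega)
    have h4 : (16 : ℝ) ≤ 2 ^ (N + 2) := by
      calc (16 : ℝ) = 2 ^ 4 := by norm_num
        _ ≤ _ := pow_le_pow_right₀ (by norm_num) (by omega)
    calc θ * (128 * ((N : ℝ) + 1) * (((M : ℝ) + 1) * (N + 1)))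
        = θ * (8 * 1 * (M + 1) * (N + 1)) * (16 * ((N : ℝ) + 1)) := by ring
      _ ≤ θ * (2 ^ (N + 1) * K * (M + 1) * (N + 1)) * (2 ^ (N + 2) * ((N : ℝ) + 1)) := by gcongr
      _ ≤ Δ * (2 ^ (N + 2) * ((N : ℝ) + 1)) := by gcongr
      _ ≤ 1 := h2.le
  obtain ⟨W₁, W₃, h1, h2, h3⟩ := core M N hM hN a R₀ α hα K C θ hK hC
    (fun p hp => hKb p (Finset.mem_insert_of_mem (Finset.mem_insert_of_mem hp))) hθ0 hθ1
    (min_le_right _ _) c hc U hU hcU u₁ u₂ σ hu₁ hu₂ hσa hσ hode hu₁c hs0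
  rw [hL]
  have hd : ∀ W : ℂ → ℂ, (∀ z ∈ ball c (θ / ‖σ c‖ ^ (M * N - 1)), DifferentiableAt ℂ W z) →
      AnalyticOnNhd ℂ W (ball c (θ / ‖σ c‖ ^ (M * N - 1))) := fun W hW =>
    DifferentiableOn.analyticOnNhd (fun z hz => (hW z hz).differentiableWithinAt) isOpen_ball
  refine ⟨W₁, fun z => W₃ z ^ (M + 1), W₃, hd _ fun z hz => (h1 z hz).2.2.1.differentiableAt,
    hd _ fun z hz => (h1 z hz).2.2.2.1.differentiableAt, hd _ fun z hz => (h1 z hz).1,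
    fun z hz => ⟨rfl, (h1 z hz).2.1, (h1 z hz).2.2.1.deriv, (h1 z hz).2.2.2.1.deriv⟩, h2, ?_⟩
  intro z hz
  have hσ0 : 0 < ‖σ c‖ := norm_pos_iff.2 hσc.2
  have hz' : ‖z - c‖ = θ / ‖σ c‖ ^ (M * N - 1) / 2 := by rw [hz]; field_simp
  refine ⟨h3 z hz', ?_⟩
  have hzb : z ∈ ball c (θ / ‖σ c‖ ^ (M * N - 1)) := by
    rw [mem_ball, dist_eq_norm, hz']
    have : 0 < θ / ‖σ c‖ ^ (M * N - 1) := by positivity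
    linarith
  rw [norm_pow]
  exact one_le_pow₀ (h1 z hzb).2.2.2.2
end
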